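/- arXiv:0903.5179 — 8 statements merged into one kernel-verified Lean document; each statement's English description precedes it below -/
import Mathlib

section
/- Let k be a positive integer and let M, N be nonnegative integers with |M − N| ≤ k. Then the alternating sum ∑_{l ∈ ℤ} (−1)^l · C(M+N, M−kl)^2 is nonnegative. -/
/-- Binomial coefficient `C(n, b)` with integer lower index, zero unless `0 ≤ b ≤ n`. -/
def zchoose (n : ℕ) (b : ℤ) : ℕ := if 0 ≤ b then n.choose b.toNat else 0

/-- The antiperiodic function on `ℤ` supported on the multiples of `k`, with value `(-1) ^ l` at
`k * l`. -/
def altIndicator (k : ℕ) (m : ℤ) : ℤ := if (k : ℤ) ∣ m then ((m / k).negOnePow : ℤ) else 0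

theorem altIndicator_neg (k : ℕ) (m : ℤ) : altIndicator k (-m) = altIndicator k m := by
  unfold altIndicator
  by_cases hm : (k : ℤ) ∣ m
  · simp [hm, Int.neg_ediv_of_dvd hm]
  · simp [hm]

theorem altIndicator_mul {k : ℕ} (hk : 0 < k) (l : ℤ) :
    altIndicator k (k * l) = (l.negOnePow : ℤ) := by
  have hk' : (k : ℤ) ≠ 0 := by exact_mod_cast hk.ne'
  simp [altIndicator, Int.mul_ediv_cancel_left _ hk']

theorem altIndicator_sub_self {k : ℕ} (hk : 0 < k) (m : ℤ) :
    altIndicator k (m - k) = -altIndicator k m := by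
  by_cases hm : (k : ℤ) ∣ m
  · obtain ⟨l, rfl⟩ := hm
    rw [show (k : ℤ) * l - k = k * (l - 1) by ring, altIndicator_mul hk, altIndicator_mul hk]
    simp [Int.negOnePow_sub]
  · have hm' : ¬ (k : ℤ) ∣ m - k := by simpa using hm
    simp [altIndicator, hm, hm']

theorem Int.coe_negOnePow_eq_pow_natAbs (l : ℤ) : (l.negOnePow : ℤ) = (-1) ^ l.natAbs := by
  rcases Int.even_or_odd l with hl | hl
  · rw [Int.negOnePow_even l hl, (Int.natAbs_even.mpr hl).neg_one_pow]; rfl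
  · rw [Int.negOnePow_odd l hl, (Int.natAbs_odd.mpr hl).neg_one_pow]; rfl

/-- The alternating sum `∑ (-1) ^ l * C(n, a - k * l)`, indexed by the lower index. -/
def altChooseSum (k n : ℕ) (a : ℤ) : ℤ :=
  ∑ j ∈ Finset.range (n + 1), (n.choose j : ℤ) * altIndicator k (a - j)

theorem altChooseSum_succ (k n : ℕ) (a : ℤ) :
    altChooseSum k (n + 1) a = altChooseSum k n a + altChooseSum k n (a - 1) := by
  unfold altChooseSum
  rw [Finset.sum_choose_succ_mul (fun j _ => altIndicator k (a - j)) n]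
  congr 1
  refine Finset.sum_congr rfl fun j _ => ?_
  rw [show a - ((j + 1 : ℕ) : ℤ) = a - 1 - j by push_cast; ring]

theorem altChooseSum_reflect (k n : ℕ) (a : ℤ) :
    altChooseSum k n (n - a) = altChooseSum k n a := by
  unfold altChooseSum
  rw [← Finset.sum_range_reflect]
  refine Finset.sum_congr rfl fun j hj => ?_
  have hj' : j ≤ n := by simpa [Nat.lt_succ_iff] using hj
  rw [show n + 1 - 1 - j = n - j by omega, Nat.choose_symm hj', ← altIndicator_neg k (a - j)]
  congr 2
  push_cast [hj']
  ring

theorem altChooseSum_sub_self {k : ℕ} (hk : 0 < k) (n : ℕ) (a : ℤ) :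
    altChooseSum k n (a - k) = -altChooseSum k n a := by
  unfold altChooseSum
  rw [← Finset.sum_neg_distrib]
  refine Finset.sum_congr rfl fun j _ => ?_
  rw [show a - k - (j : ℤ) = a - j - k by ring, altIndicator_sub_self hk, mul_neg]

theorem altChooseSum_eq_zero {k : ℕ} (hk : 0 < k) {n : ℕ} {a : ℤ} (h : |2 * a - n| = k) :
    altChooseSum k n a = 0 := by
  have hr := altChooseSum_reflect k n a
  rcases (abs_eq (by positivity)).mp h with h | h
  · rw [show (n : ℤ) - a = a - k by linarith, altChooseSum_sub_self hk] at hr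
    linarith
  · have hs := altChooseSum_sub_self hk n (n - a)
    rw [show (n : ℤ) - a - k = a by linarith] at hs
    linarith

theorem altChooseSum_nonneg {k : ℕ} (hk : 0 < k) {n : ℕ} {a : ℤ} (h : |2 * a - n| ≤ k) :
    0 ≤ altChooseSum k n a := by
  induction n generalizing a with
  | zero =>
    simp only [altChooseSum, altIndicator]
    by_cases ha : (k : ℤ) ∣ a
    · have : a = 0 := by
        refine Int.eq_zero_of_abs_lt_dvd ha ?_
        simp only [Nat.cast_zero, sub_zero, abs_mul] at h
        norm_num at h
        have : (0 : ℤ) < k := by exact_mod_cast hk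
        linarith [abs_nonneg a]
      simp [this]
    · simp [ha]
  | succ n ih =>
    rcases h.eq_or_lt with h | h
    · exact (altChooseSum_eq_zero hk h).ge
    · rw [altChooseSum_succ]
      rw [abs_lt] at h
      push_cast at h
      refine add_nonneg (ih ?_) (ih ?_) <;> rw [abs_le] <;> constructor <;> linarith

theorem Nat.multinomial_choose_eq (i p q : ℕ) :
    (i + p + (i + q)).choose (i + p) * ((i + q).choose i * (i + p).choose i) =
      (2 * i + (p + q)).choose (2 * i) * (2 * i).choose i * (p + q).choose p := by
  have h2 : ((2 * i).choose i : ℚ) = (2 * i).factorial / (i.factorial * i.factorial) := by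
    rw [two_mul, Nat.cast_add_choose]
  have hs : i + p + (i + q) = 2 * i + (p + q) := by ring
  have key : ((i + p + (i + q)).choose (i + p) * ((i + q).choose i * (i + p).choose i) : ℚ) =
      (2 * i + (p + q)).choose (2 * i) * (2 * i).choose i * (p + q).choose p := by
    rw [h2]
    simp only [Nat.cast_add_choose]
    rw [hs]
    have := fun n : ℕ => (Nat.cast_ne_zero (R := ℚ)).mpr n.factorial_ne_zero
    field_simp [this]
  exact_mod_cast key

theorem Nat.choose_sq_eq_sum {n j : ℕ} (hj : j ≤ n) :
    n.choose j ^ 2 = ∑ i ∈ Finset.range (j + 1),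
      n.choose (2 * i) * (2 * i).choose i * (n - 2 * i).choose (j - i) := by
  have hv : n.choose j = ∑ i ∈ Finset.range (j + 1), (n - j).choose i * j.choose i := by
    conv_lhs => rw [← Nat.sub_add_cancel hj]
    rw [Nat.add_choose_eq, Finset.Nat.sum_antidiagonal_eq_sum_range_succ_mk]
    refine Finset.sum_congr rfl fun i hi => ?_
    rw [Nat.choose_symm (by simpa [Nat.lt_succ_iff] using hi)]
  rw [sq]
  nth_rewrite 2 [hv]
  rw [Finset.mul_sum]
  refine Finset.sum_congr rfl fun i hi => ?_
  obtain ⟨p, rfl⟩ := Nat.exists_eq_add_of_le (show i ≤ j by simpa [Nat.lt_succ_iff] using hi)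
  obtain ⟨r, rfl⟩ := Nat.exists_eq_add_of_le hj
  rcases le_or_gt i r with hr | hr
  · obtain ⟨q, rfl⟩ := Nat.exists_eq_add_of_le hr
    rw [show i + p + (i + q) - (i + p) = i + q by omega, Nat.multinomial_choose_eq,
      show i + p + (i + q) - 2 * i = p + q by omega,
      show i + p + (i + q) = 2 * i + (p + q) by ring, Nat.add_sub_cancel_left]
  · rw [show i + p + r - (i + p) = r by omega, Nat.choose_eq_zero_of_lt hr]
    rcases le_or_gt (2 * i) (i + p + r) with h | h
    · rw [Nat.choose_eq_zero_of_lt (show i + p + r - 2 * i < i + p - i by omega)]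
      simp
    · rw [Nat.choose_eq_zero_of_lt h]
      simp

theorem sum_choose_sq_mul_altIndicator (k n : ℕ) (a : ℤ) :
    ∑ j ∈ Finset.range (n + 1), (n.choose j : ℤ) ^ 2 * altIndicator k (a - j) =
      ∑ i ∈ Finset.range (n + 1),
        ((n.choose (2 * i) * (2 * i).choose i : ℕ) : ℤ) * altChooseSum k (n - 2 * i) (a - i) := by
  have hsq : ∀ j ∈ Finset.range (n + 1), (n.choose j : ℤ) ^ 2 * altIndicator k (a - j) =
      ∑ i ∈ Finset.range (j + 1), ((n.choose (2 * i) * (2 * i).choose i : ℕ) : ℤ) *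
        (((n - 2 * i).choose (j - i) : ℤ) * altIndicator k (a - j)) := by
    intro j hj
    rw [← Nat.cast_pow, Nat.choose_sq_eq_sum (by simpa [Nat.lt_succ_iff] using hj), Nat.cast_sum,
      Finset.sum_mul]
    refine Finset.sum_congr rfl fun i _ => ?_
    push_cast
    ring
  rw [Finset.sum_congr rfl hsq, Finset.sum_comm' (s' := fun i => Finset.Ico i (n + 1))
    (t' := Finset.range (n + 1)) (by intro x y; simp only [Finset.mem_range, Finset.mem_Ico]; omega)]
  refine Finset.sum_congr rfl fun i _ => ?_
  rw [← Finset.mul_sum, Finset.sum_Ico_eq_sum_range]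
  rcases le_or_gt (2 * i) n with h | h
  · congr 1
    unfold altChooseSum
    symm
    have hsub : Finset.range (n - 2 * i + 1) ⊆ Finset.range (n + 1 - i) := by
      intro x
      simp only [Finset.mem_range]
      omega
    rw [← Finset.sum_subset hsub]
    · refine Finset.sum_congr rfl fun m _ => ?_
      rw [Nat.add_sub_cancel_left, Nat.cast_add, sub_sub]
    · intro m _ hm
      rw [Nat.add_sub_cancel_left, Nat.choose_eq_zero_of_lt (by simpa using hm)]
      simp
  · simp [Nat.choose_eq_zero_of_lt h]

theorem sum_negOnePow_mul_zchoose_sq {k M : ℕ} (hk : 0 < k) (N : ℕ) :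
    ∑ l ∈ Finset.Icc (-((M : ℤ) + N)) ((M : ℤ) + N),
      (-1 : ℤ) ^ l.natAbs * (zchoose (M + N) ((M : ℤ) - k * l) : ℤ) ^ 2 =
    ∑ j ∈ Finset.range (M + N + 1),
      ((M + N).choose j : ℤ) ^ 2 * altIndicator k ((M : ℤ) - j) := by
  have hk' : (0 : ℤ) < k := by exact_mod_cast hk
  rw [← Finset.sum_filter_of_ne (p := fun j : ℕ => (k : ℤ) ∣ (M : ℤ) - j)
    (by intro j _ hj; by_contra hd; simp [altIndicator, hd] at hj)]
  symm
  refine Finset.sum_of_injOn (fun j : ℕ => ((M : ℤ) - j) / k) ?_ ?_ ?_ ?_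
  · intro i hi j hj hij
    simp only [Finset.coe_filter, Set.mem_ofPred_eq] at hi hj
    have := Int.ediv_left_inj hi.2 hj.2 |>.mp hij
    omega
  · intro j hj
    simp only [Finset.coe_filter, Set.mem_ofPred_eq, Finset.mem_range] at hj
    obtain ⟨hj, l, hl⟩ := hj
    simp only [hl, Int.mul_ediv_cancel_left _ hk'.ne', Finset.coe_Icc, Set.mem_Icc]
    constructor <;> by_contra! <;> nlinarith
  · intro l _ hl
    by_cases h0 : 0 ≤ (M : ℤ) - k * l
    · rcases lt_or_ge (M + N) ((M : ℤ) - k * l).toNat with h1 | h1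
      · simp [zchoose, Nat.choose_eq_zero_of_lt h1]
      · refine absurd ⟨((M : ℤ) - k * l).toNat, ?_, ?_⟩ hl
        · simp only [Finset.coe_filter, Set.mem_ofPred_eq, Finset.mem_range, Int.toNat_of_nonneg h0]
          exact ⟨by omega, by simp⟩
        · simp [Int.toNat_of_nonneg h0, Int.mul_ediv_cancel_left _ hk'.ne']
    · rw [zchoose, if_neg h0]; simp
  · intro j hj
    obtain ⟨-, l, hl⟩ := Finset.mem_filter.mp hj
    simp only [hl, Int.mul_ediv_cancel_left _ hk'.ne', altIndicator_mul hk,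
      Int.coe_negOnePow_eq_pow_natAbs]
    rw [← hl, sub_sub_cancel, mul_comm]
    simp [zchoose]

theorem stmt0 (k M N : ℕ) (hk : 0 < k) (h : |(M : ℤ) - N| ≤ k) :
    0 ≤ ∑ l ∈ Finset.Icc (-((M : ℤ) + N)) ((M : ℤ) + N),
      (-1 : ℤ) ^ l.natAbs * (zchoose (M + N) ((M : ℤ) - k * l) : ℤ) ^ 2 := by
  rw [sum_negOnePow_mul_zchoose_sq hk, sum_choose_sq_mul_altIndicator]
  refine Finset.sum_nonneg fun i _ => ?_
  rcases le_or_gt (2 * i) (M + N) with hi | hi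
  · refine mul_nonneg (by positivity) (altChooseSum_nonneg hk ?_)
    rw [Nat.cast_sub hi]
    push_cast
    rwa [show 2 * ((M : ℤ) - i) - (M + N - 2 * i) = M - N by ring]
  · simp [Nat.choose_eq_zero_of_lt hi]
end

section
/- Let k be a positive integer and let M, N be nonnegative integers. Then the alternating sum ∑_{l ∈ ℤ} (−1)^l · C(M+N, M−kl) · C(M+N, N−kl) is nonnegative. -/
open Polynomial in
theorem Polynomial.coeff_pow_nonneg {p : ℝ[X]} (hp : ∀ i, 0 ≤ p.coeff i) (n i : ℕ) :
    0 ≤ (p ^ n).coeff i := by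
  induction n generalizing i with
  | zero => rw [pow_zero, coeff_one]; split_ifs <;> norm_num
  | succ n ih =>
    rw [pow_succ, coeff_mul]
    exact Finset.sum_nonneg fun x _ => mul_nonneg (ih _) (hp _)

open Polynomial in
theorem Polynomial.coeff_one_add_C_mul_X_pow {R : Type*} [CommSemiring R] (w : R) (n i : ℕ) :
    ((1 + C w * X) ^ n).coeff i = n.choose i * w ^ i := by
  have h : (1 + C w * X) ^ n = ((1 + X) ^ n).comp (C w * X) := by simp
  rw [h, comp_C_mul_X_coeff, coeff_one_add_X_pow]

theorem zchoose_natCast (n a : ℕ) : zchoose n a = n.choose a := by simp [zchoose]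

theorem zchoose_of_neg (n : ℕ) {b : ℤ} (hb : b < 0) : zchoose n b = 0 := by
  simp [zchoose, hb.not_ge]

theorem zchoose_of_lt {n : ℕ} {b : ℤ} (hb : n < b) : zchoose n b = 0 := by
  lift b to ℕ using by omega
  rw [zchoose_natCast, Nat.choose_eq_zero_of_lt (by omega)]

theorem zchoose_symm (n : ℕ) (b : ℤ) : zchoose n (n - b) = zchoose n b := by
  rcases lt_or_ge b 0 with hb | hb
  · rw [zchoose_of_neg n hb, zchoose_of_lt (by omega)]
  rcases lt_or_ge (n : ℤ) b with hn | hn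
  · rw [zchoose_of_lt hn, zchoose_of_neg n (by omega)]
  lift b to ℕ using hb
  have hn' : b ≤ n := by omega
  rw [← Nat.cast_sub hn', zchoose_natCast, zchoose_natCast, Nat.choose_symm hn']

open Polynomial in
/-- The sum is the coefficient of `X ^ (2 * m)` in `((1 + w X) (1 + w⁻¹ X)) ^ n`, and the quadratic
`(1 + w X) (1 + w⁻¹ X) = 1 + 2 (re w) X + X ^ 2` has nonnegative coefficients when `0 ≤ re w`. -/
theorem re_sum_antidiagonal_nonneg_of_re_nonneg {w : ℂ} (hw : ‖w‖ = 1) (hre : 0 ≤ w.re)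
    (n m : ℕ) :
    0 ≤ (∑ x ∈ Finset.HasAntidiagonal.antidiagonal (2 * m),
      (n.choose x.1 * w ^ x.1 * (n.choose x.2 * w⁻¹ ^ x.2) : ℂ)).re := by
  have hw0 : w ≠ 0 := by rintro rfl; simp at hw
  have hinv : w + w⁻¹ = ((2 * w.re : ℝ) : ℂ) := by
    rw [Complex.inv_eq_conj hw, Complex.add_conj]
  have hprod : (1 + C w * X) * (1 + C w⁻¹ * X) =
      (1 + C (2 * w.re) * X + X ^ 2 : ℝ[X]).map Complex.ofRealHom := by
    have h1 : (C w * C w⁻¹ : ℂ[X]) = 1 := by rw [← C_mul, mul_inv_cancel₀ hw0, C_1]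
    have h2 : (C w + C w⁻¹ : ℂ[X]) = C ((2 * w.re : ℝ) : ℂ) := by rw [← C_add, hinv]
    simp only [Polynomial.map_add, Polynomial.map_mul, Polynomial.map_pow, Polynomial.map_one,
      map_X, map_C, Complex.ofRealHom_eq_coe]
    linear_combination X ^ 2 * h1 + X * h2
  have hcoeff : ∀ i, 0 ≤ (1 + C (2 * w.re) * X + X ^ 2 : ℝ[X]).coeff i := by
    intro i
    simp only [coeff_add, coeff_one, coeff_C_mul, coeff_X, coeff_X_pow]
    split_ifs <;> simp <;> linarith
  have key : (∑ x ∈ Finset.HasAntidiagonal.antidiagonal (2 * m),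
      (n.choose x.1 * w ^ x.1 * (n.choose x.2 * w⁻¹ ^ x.2) : ℂ)) =
      (((1 + C (2 * w.re) * X + X ^ 2 : ℝ[X]) ^ n).coeff (2 * m) : ℝ) := by
    rw [← Complex.ofRealHom_eq_coe, ← coeff_map, Polynomial.map_pow, ← hprod, mul_pow, coeff_mul]
    simp only [coeff_one_add_C_mul_X_pow]
  rw [key, Complex.ofReal_re]
  exact coeff_pow_nonneg hcoeff n _

theorem re_sum_antidiagonal_nonneg {w : ℂ} (hw : ‖w‖ = 1) (n m : ℕ) :
    0 ≤ (∑ x ∈ Finset.HasAntidiagonal.antidiagonal (2 * m),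
      (n.choose x.1 * w ^ x.1 * (n.choose x.2 * w⁻¹ ^ x.2) : ℂ)).re := by
  rcases le_total 0 w.re with h | h
  · exact re_sum_antidiagonal_nonneg_of_re_nonneg hw h n m
  · have := re_sum_antidiagonal_nonneg_of_re_nonneg (w := -w) (by simpa using hw)
      (by simpa using h) n m
    convert this using 3 with x hx
    have hsum : (-1 : ℂ) ^ x.1 * (-1) ^ x.2 = 1 := by
      rw [← pow_add, Finset.HasAntidiagonal.mem_antidiagonal.1 hx, pow_mul]; simp
    rw [inv_neg, neg_pow w, neg_pow w⁻¹]
    linear_combination (-(n.choose x.1 * w ^ x.1 * (n.choose x.2 * w⁻¹ ^ x.2)) : ℂ) * hsum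

theorem sum_antidiagonal_eq_sum_Icc {w : ℂ} (hw : w ≠ 0) (n m r : ℕ) (hr : m ≤ r) :
    ∑ x ∈ Finset.HasAntidiagonal.antidiagonal (2 * m),
      (n.choose x.1 * w ^ x.1 * (n.choose x.2 * w⁻¹ ^ x.2) : ℂ) =
    ∑ j ∈ Finset.Icc (-(r : ℤ)) r,
      (zchoose n (m - j) * zchoose n (m + j) : ℂ) * (w ^ 2) ^ j := by
  refine Finset.sum_bij_ne_zero (fun x _ _ => (x.1 : ℤ) - m) ?_ ?_ ?_ ?_
  · intro x hx _
    have := Finset.HasAntidiagonal.mem_antidiagonal.1 hx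
    rw [Finset.mem_Icc]; omega
  · intro x hx _ y hy _ hxy
    have := Finset.HasAntidiagonal.mem_antidiagonal.1 hx
    have := Finset.HasAntidiagonal.mem_antidiagonal.1 hy
    ext <;> omega
  · intro j _ hj
    have h1 : 0 ≤ (m : ℤ) - j := by
      by_contra! h
      simp [zchoose_of_neg n h] at hj
    have h2 : 0 ≤ (m : ℤ) + j := by
      by_contra! h
      simp [zchoose_of_neg n h] at hj
    have e1 : (m : ℤ) - j = ((m - j).toNat : ℤ) := by omega
    have e2 : (m : ℤ) + j = ((m + j).toNat : ℤ) := by omega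
    refine ⟨((m + j).toNat, (m - j).toNat), ?_, ?_, ?_⟩
    · rw [Finset.HasAntidiagonal.mem_antidiagonal]; omega
    · rw [e1, e2, zchoose_natCast, zchoose_natCast] at hj
      have hchoose := left_ne_zero_of_mul hj
      exact mul_ne_zero (mul_ne_zero (right_ne_zero_of_mul hchoose) (pow_ne_zero _ hw))
        (mul_ne_zero (left_ne_zero_of_mul hchoose) (pow_ne_zero _ (inv_ne_zero hw)))
    · omega
  · intro x hx _
    have hx' := Finset.HasAntidiagonal.mem_antidiagonal.1 hx
    have e1 : (m : ℤ) - (x.1 - m) = x.2 := by omega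
    have e2 : (m : ℤ) + (x.1 - m) = x.1 := by omega
    have e3 : (2 : ℤ) * (x.1 - m) = x.1 + -x.2 := by omega
    rw [e1, e2, zchoose_natCast, zchoose_natCast, ← zpow_natCast w 2, ← zpow_mul, Nat.cast_ofNat,
      e3, zpow_add₀ hw, zpow_neg, zpow_natCast, zpow_natCast, inv_pow]
    ring

theorem IsPrimitiveRoot.sum_pow_zpow {K : Type*} [Field K] {η : K} {k : ℕ}
    (hη : IsPrimitiveRoot η k) (j : ℤ) :
    ∑ i ∈ Finset.range k, (η ^ i) ^ j = if (k : ℤ) ∣ j then (k : K) else 0 := by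
  have hswap : ∀ i : ℕ, (η ^ i) ^ j = (η ^ j) ^ i := fun i => by
    rw [← zpow_natCast, ← zpow_natCast, zpow_comm]
  simp only [hswap]
  split_ifs with h
  · rw [(hη.zpow_eq_one_iff_dvd j).2 h]; simp
  · have hne : η ^ j ≠ 1 := fun h' => h ((hη.zpow_eq_one_iff_dvd j).1 h')
    rw [geom_sum_eq hne, ← hswap, hη.pow_eq_one]; simp

theorem stmt1 (k M N : ℕ) (hk : 0 < k) :
    0 ≤ ∑ l ∈ Finset.Icc (-((M : ℤ) + N)) ((M : ℤ) + N),
      (-1 : ℤ) ^ l.natAbs *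
        ((zchoose (M + N) ((M : ℤ) - k * l) : ℤ) * (zchoose (M + N) ((N : ℤ) - k * l) : ℤ)) := by
  set n := M + N with hn
  set S := ∑ l ∈ Finset.Icc (-((M : ℤ) + N)) ((M : ℤ) + N), (-1 : ℤ) ^ l.natAbs *
    ((zchoose n ((M : ℤ) - k * l) : ℤ) * (zchoose n ((N : ℤ) - k * l) : ℤ)) with hS
  have hk0 : (k : ℂ) ≠ 0 := by exact_mod_cast hk.ne'
  set ζ : ℂ := Complex.exp (Real.pi * Complex.I / (2 * k)) with hζ
  have hζ_norm : ‖ζ‖ = 1 := by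
    have : (Real.pi * Complex.I / (2 * k) : ℂ) = ((Real.pi / (2 * k) : ℝ) : ℂ) * Complex.I := by
      push_cast; ring
    rw [hζ, this, Complex.norm_exp_ofReal_mul_I]
  have hζ0 : ζ ≠ 0 := Complex.exp_ne_zero _
  have hζ_pow : (ζ ^ 2) ^ k = -1 := by
    rw [← pow_mul, hζ, ← Complex.exp_nat_mul, ← Complex.exp_pi_mul_I]
    congr 1; push_cast; field_simp
  have hη : IsPrimitiveRoot ((ζ ^ 2) ^ 2) k := by
    convert Complex.isPrimitiveRoot_exp k hk.ne' using 1
    rw [← pow_mul, hζ, ← Complex.exp_nat_mul]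
    congr 1; push_cast; field_simp; norm_num
  have hfilter : ∀ j : ℤ, ∑ i ∈ Finset.range k, ((ζ * (ζ ^ 2) ^ i) ^ 2) ^ j =
      if (k : ℤ) ∣ j then k * (ζ ^ 2) ^ j else 0 := by
    intro j
    have h : ∀ i : ℕ, ((ζ * (ζ ^ 2) ^ i) ^ 2) ^ j = (ζ ^ 2) ^ j * (((ζ ^ 2) ^ 2) ^ i) ^ j := by
      intro i
      rw [← mul_zpow]; congr 1; ring
    simp only [h, ← Finset.mul_sum, hη.sum_pow_zpow j]
    split_ifs <;> ring
  have hsum : ((k * S : ℤ) : ℂ) = ∑ i ∈ Finset.range k,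
      ∑ x ∈ Finset.HasAntidiagonal.antidiagonal (2 * M), (n.choose x.1 * (ζ * (ζ ^ 2) ^ i) ^ x.1 *
        (n.choose x.2 * (ζ * (ζ ^ 2) ^ i)⁻¹ ^ x.2) : ℂ) := by
    have hMr : M ≤ k * n := le_trans (by omega) (Nat.le_mul_of_pos_left n hk)
    simp only [fun i : ℕ => sum_antidiagonal_eq_sum_Icc
      (mul_ne_zero hζ0 (pow_ne_zero i (pow_ne_zero 2 hζ0))) n M (k * n) hMr]
    rw [Finset.sum_comm]
    simp only [← Finset.mul_sum, hfilter, mul_ite, mul_zero]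
    rw [← Finset.sum_filter]
    have himage : (Finset.Icc (-((k * n : ℕ) : ℤ)) ((k * n : ℕ) : ℤ)).filter ((k : ℤ) ∣ ·) =
        (Finset.Icc (-((M : ℤ) + N)) ((M : ℤ) + N)).image ((k : ℤ) * ·) := by
      have hkZ : (0 : ℤ) < k := by exact_mod_cast hk
      ext j
      simp only [Finset.mem_filter, Finset.mem_image, Finset.mem_Icc, hn]
      push_cast
      constructor
      · rintro ⟨⟨h1, h2⟩, l, rfl⟩
        exact ⟨l, ⟨by nlinarith, by nlinarith⟩, rfl⟩
      · rintro ⟨l, ⟨h1, h2⟩, rfl⟩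
        exact ⟨⟨by nlinarith, by nlinarith⟩, dvd_mul_right _ _⟩
    rw [himage, Finset.sum_image fun a _ b _ hab =>
      mul_left_cancel₀ (by exact_mod_cast hk.ne' : (k : ℤ) ≠ 0) hab, hS, Finset.mul_sum]
    push_cast
    refine Finset.sum_congr rfl fun l _ => ?_
    have hsymm : zchoose n ((N : ℤ) - k * l) = zchoose n (M + k * l) := by
      rw [← zchoose_symm]; congr 1; push_cast [hn]; ring
    have hsign : ((-1 : ℂ)) ^ l = (-1) ^ l.natAbs := by
      rcases Int.natAbs_eq l with h | h
      · conv_lhs => rw [h]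
        rw [zpow_natCast]
      · conv_lhs => rw [h]
        rw [zpow_neg, zpow_natCast, ← inv_pow]; norm_num
    rw [hsymm, zpow_mul, zpow_natCast, hζ_pow, hsign]
    ring
  have hre : (0 : ℝ) ≤ ((k * S : ℤ) : ℂ).re := by
    rw [hsum, Complex.re_sum]
    exact Finset.sum_nonneg fun i _ => re_sum_antidiagonal_nonneg (by simp [hζ_norm]) n M
  rw [Complex.intCast_re] at hre
  exact nonneg_of_mul_nonneg_right (by exact_mod_cast hre) (by exact_mod_cast hk : (0 : ℤ) < k)
end

section
/- Let k be a positive integer and let M, N be nonnegative integers. Then there exist finitely many nonnegative integers a_0, a_1, …, a_m such that for every real number x, ∑_{l ∈ ℤ} C(M+N, M−kl) · C(M+N, N−kl) · cos(l·x) = ∑_{p=0}^{m} a_p · (1 + cos x)^p. In other words, the trigonometric polynomial ∑_{l} C(M+N, M−kl) C(M+N, N−kl) cos(lx) is a polynomial in 1 + cos(x) with nonnegative integral coefficients. -/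
open Polynomial in
/-- `h` is a polynomial in `1 + cos x` with nonnegative real coefficients. -/
def IsNonnegPolyCos (h : ℝ → ℝ) : Prop :=
  ∃ R : ℝ[X], (∀ i, 0 ≤ R.coeff i) ∧ ∀ x, h x = R.eval (1 + Real.cos x)

namespace IsNonnegPolyCos

open Polynomial

theorem const {c : ℝ} (hc : 0 ≤ c) : IsNonnegPolyCos fun _ => c := by
  refine ⟨C c, fun i => ?_, fun x => by simp⟩
  rw [coeff_C]
  split_ifs <;> simp [hc]

theorem one_add_cos : IsNonnegPolyCos fun x => 1 + Real.cos x := by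
  refine ⟨X, fun i => ?_, fun x => by simp⟩
  rw [coeff_X]
  split_ifs <;> simp

theorem add {f g : ℝ → ℝ} (hf : IsNonnegPolyCos f) (hg : IsNonnegPolyCos g) :
    IsNonnegPolyCos fun x => f x + g x := by
  obtain ⟨R, hR, hfR⟩ := hf
  obtain ⟨S, hS, hgS⟩ := hg
  refine ⟨R + S, fun i => ?_, fun x => by simp [hfR, hgS]⟩
  rw [coeff_add]
  exact add_nonneg (hR i) (hS i)

theorem mul {f g : ℝ → ℝ} (hf : IsNonnegPolyCos f) (hg : IsNonnegPolyCos g) :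
    IsNonnegPolyCos fun x => f x * g x := by
  obtain ⟨R, hR, hfR⟩ := hf
  obtain ⟨S, hS, hgS⟩ := hg
  refine ⟨R * S, fun i => ?_, fun x => by simp [hfR, hgS]⟩
  rw [coeff_mul]
  exact Finset.sum_nonneg fun p _ => mul_nonneg (hR _) (hS _)

theorem sum {ι : Type*} (s : Finset ι) {f : ι → ℝ → ℝ} (hf : ∀ i ∈ s, IsNonnegPolyCos (f i)) :
    IsNonnegPolyCos fun x => ∑ i ∈ s, f i x := by
  classical
  induction s using Finset.induction_on with
  | empty => simpa using const le_rfl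
  | insert a s ha ih =>
    simp only [Finset.sum_insert ha]
    exact (hf a (by simp)).add (ih fun i hi => hf i (by simp [hi]))

end IsNonnegPolyCos

/-- The sum of `g` over the `k` points `θ` (modulo `2π`) with `k θ = x` (modulo `2π`). -/
noncomputable def fiberSum (k : ℕ) (g : ℝ → ℝ) (x : ℝ) : ℝ :=
  ∑ j ∈ Finset.range k, g ((x + 2 * Real.pi * j) / k)

theorem fiberSum_add (k : ℕ) (f g : ℝ → ℝ) (x : ℝ) :
    fiberSum k (fun θ => f θ + g θ) x = fiberSum k f x + fiberSum k g x :=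
  Finset.sum_add_distrib

theorem fiberSum_const_mul (k : ℕ) (c : ℝ) (g : ℝ → ℝ) (x : ℝ) :
    fiberSum k (fun θ => c * g θ) x = c * fiberSum k g x :=
  (Finset.mul_sum _ _ _).symm

theorem fiberSum_sum {ι : Type*} (k : ℕ) (s : Finset ι) (f : ι → ℝ → ℝ) (x : ℝ) :
    fiberSum k (fun θ => ∑ i ∈ s, f i θ) x = ∑ i ∈ s, fiberSum k (f i) x :=
  Finset.sum_comm

theorem fiberSum_cos {k : ℕ} (hk : 0 < k) (m : ℤ) (x : ℝ) :
    fiberSum k (fun θ => Real.cos (m * θ)) x =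
      if (k : ℤ) ∣ m then k * Real.cos ((m / k : ℤ) * x) else 0 := by
  have hk0 : (k : ℝ) ≠ 0 := by positivity
  have hkc : (k : ℂ) ≠ 0 := by exact_mod_cast hk.ne'
  unfold fiberSum
  split_ifs with h
  · obtain ⟨l, rfl⟩ := h
    rw [Int.mul_ediv_cancel_left _ (by exact_mod_cast hk.ne')]
    have : ∀ j ∈ Finset.range k,
        Real.cos (((k * l : ℤ) : ℝ) * ((x + 2 * Real.pi * j) / k)) = Real.cos (l * x) := by
      intro j _
      rw [← Real.cos_add_int_mul_two_pi (l * x) (l * j)]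
      congr 1
      push_cast
      field_simp
    rw [Finset.sum_congr rfl this]
    simp
  · set z : ℂ := Complex.exp (2 * Real.pi * Complex.I * m / k) with hz
    have hz1 : z ≠ 1 := by
      intro h1
      obtain ⟨n, hn⟩ := Complex.exp_eq_one_iff.mp h1
      apply h
      refine ⟨n, ?_⟩
      have hpi := Complex.two_pi_I_ne_zero
      have : (m : ℂ) = k * n := by
        field_simp at hn
        linear_combination hn
      exact_mod_cast this
    have hzk : z ^ k = 1 := by
      rw [hz, ← Complex.exp_nat_mul, Complex.exp_eq_one_iff]
      exact ⟨m, by field_simp⟩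
    have hgeom : ∑ j ∈ Finset.range k, z ^ j = 0 := by
      have := mul_geom_sum z k
      rw [hzk, sub_self] at this
      exact (mul_eq_zero.mp this).resolve_left (sub_ne_zero.mpr hz1)
    have hre : ∀ j ∈ Finset.range k, Real.cos (m * ((x + 2 * Real.pi * j) / k)) =
        (Complex.exp ((m * x / k : ℝ) * Complex.I) * z ^ j).re := by
      intro j _
      rw [hz, ← Complex.exp_nat_mul, ← Complex.exp_add, ← Complex.exp_ofReal_mul_I_re]
      congr 2
      push_cast
      field_simp
    rw [Finset.sum_congr rfl hre, ← Complex.re_sum, ← Finset.mul_sum, hgeom]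
    simp

theorem prod_two_cos_sub_two_cos {k : ℕ} (hk : 0 < k) (θ x : ℝ) :
    ∏ j ∈ Finset.range k, (2 * Real.cos θ - 2 * Real.cos ((x + 2 * Real.pi * j) / k)) =
      2 * Real.cos (k * θ) - 2 * Real.cos x := by
  have hkc : (k : ℂ) ≠ 0 := by exact_mod_cast hk.ne'
  have key : ∀ {ζ : ℂ} (_ : IsPrimitiveRoot ζ k) (u a : ℂ),
      ∏ j ∈ Finset.range k, (u - ζ ^ j * a) = u ^ k - a ^ k := by
    intro ζ hζ u a
    have := congrArg (Polynomial.eval u) (X_pow_sub_C_eq_prod hζ (α := a) hk rfl)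
    simpa [Polynomial.eval_prod] using this.symm
  have hζ := Complex.isPrimitiveRoot_exp k hk.ne'
  have cosexp : ∀ t : ℂ, 2 * Complex.cos t =
      Complex.exp (t * Complex.I) + Complex.exp (-(t * Complex.I)) := by
    intro t
    rw [Complex.two_cos, neg_mul]
  have fac : ∀ s t : ℂ, 2 * Complex.cos s - 2 * Complex.cos t =
      (Complex.exp (s * Complex.I) - Complex.exp (t * Complex.I)) *
        (1 - Complex.exp (-(t * Complex.I)) * Complex.exp (-(s * Complex.I))) := by
    intro s t
    rw [cosexp, cosexp]
    have h1 : Complex.exp (s * Complex.I) * Complex.exp (-(s * Complex.I)) = 1 := by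
      rw [← Complex.exp_add]; simp
    have h2 : Complex.exp (t * Complex.I) * Complex.exp (-(t * Complex.I)) = 1 := by
      rw [← Complex.exp_add]; simp
    linear_combination Complex.exp (-(t * Complex.I)) * h1 - Complex.exp (-(s * Complex.I)) * h2
  apply Complex.ofReal_injective
  push_cast
  simp only [fac]
  rw [Finset.prod_mul_distrib]
  congr 1
  · have := key hζ (Complex.exp (θ * Complex.I)) (Complex.exp (x / k * Complex.I))
    simp only [← Complex.exp_nat_mul, ← Complex.exp_add] at this
    convert this using 1
    · refine Finset.prod_congr rfl fun j _ => ?_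
      congr 2
      field_simp
      ring
    · congr 2 <;> field_simp
  · have := key hζ.inv 1 (Complex.exp (-(x / k * Complex.I)) * Complex.exp (-(θ * Complex.I)))
    simp only [← Complex.exp_nat_mul, ← Complex.exp_add, ← Complex.exp_neg, one_pow] at this
    rw [← Complex.exp_add]
    convert this using 1
    · refine Finset.prod_congr rfl fun j _ => ?_
      rw [← Complex.exp_add]
      congr 2
      field_simp
      ring
    · congr 2
      field_simp

/-- The roots of `2 + 2 cos (k θ)` as a polynomial in `2 + 2 cos θ`, in increasing order. -/
theorem exists_ordered_nodes {k : ℕ} (hk : 0 < k) :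
    ∃ μ : ℕ → ℝ, (∀ i, 0 ≤ μ i) ∧ (∀ i j, i ≤ j → j < k → μ i ≤ μ j) ∧
      (∀ θ : ℝ, ∏ i ∈ Finset.range k, (2 + 2 * Real.cos θ - μ i) = 2 + 2 * Real.cos (k * θ)) ∧
      ∀ j < k, ∃ i < k, 2 + 2 * Real.cos ((Real.pi + 2 * Real.pi * j) / k) = μ i := by
  let y : Fin k → ℝ := fun j => 2 + 2 * Real.cos ((Real.pi + 2 * Real.pi * (j : ℕ)) / k)
  have hy : ∀ j, 0 ≤ y j := fun j => by
    have := Real.neg_one_le_cos ((Real.pi + 2 * Real.pi * (j : ℕ)) / k)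
    simp only [y]
    linarith
  let μ : ℕ → ℝ := fun n => if h : n < k then y (Tuple.sort y ⟨n, h⟩) else 0
  have hμ : ∀ i : Fin k, μ i = y (Tuple.sort y i) := fun i => by simp [μ]
  refine ⟨μ, fun i => ?_, fun i j hij hj => ?_, fun θ => ?_, fun j hj => ?_⟩
  · simp only [μ]
    split_ifs
    exacts [hy _, le_rfl]
  · rw [hμ ⟨i, hij.trans_lt hj⟩, hμ ⟨j, hj⟩]
    exact Tuple.monotone_sort y (by simpa using hij)
  · have h1 := prod_two_cos_sub_two_cos hk θ Real.pi
    rw [Real.cos_pi, ← Fin.prod_univ_eq_prod_range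
      (fun j => 2 * Real.cos θ - 2 * Real.cos ((Real.pi + 2 * Real.pi * (j : ℕ)) / k))] at h1
    rw [← Fin.prod_univ_eq_prod_range (fun i => 2 + 2 * Real.cos θ - μ i)]
    simp only [hμ]
    rw [Equiv.prod_comp (Tuple.sort y) (fun i => 2 + 2 * Real.cos θ - y i)]
    simp only [y, add_sub_add_left_eq_sub]
    rw [h1]
    ring
  · refine ⟨(Tuple.sort y).symm ⟨j, hj⟩, Fin.is_lt _, ?_⟩
    rw [hμ]
    simp [y]

/-- The fiber sum of a trigonometric polynomial of degree less than `k` is constant. -/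
theorem fiberSum_cos_mul_prod_const {k : ℕ} (μ : ℕ → ℝ) (s : ℕ) :
    ∀ m : ℤ, |m| + s < k → ∀ x x' : ℝ,
      fiberSum k (fun θ => Real.cos (m * θ) *
        ∏ i ∈ Finset.range s, (2 + 2 * Real.cos θ - μ i)) x =
      fiberSum k (fun θ => Real.cos (m * θ) *
        ∏ i ∈ Finset.range s, (2 + 2 * Real.cos θ - μ i)) x' := by
  induction s with
  | zero =>
    intro m hm x x'
    have hk : 0 < k := by have := abs_nonneg m; omega
    simp only [Finset.range_zero, Finset.prod_empty, mul_one, fiberSum_cos hk]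
    split_ifs with h
    · rw [Int.eq_zero_of_abs_lt_dvd h (by simpa using hm)]
      simp
    · rfl
  | succ s ih =>
    intro m hm x x'
    have hsplit : ∀ θ : ℝ, Real.cos (m * θ) *
        ∏ i ∈ Finset.range (s + 1), (2 + 2 * Real.cos θ - μ i) =
        (Real.cos ((m + 1 : ℤ) * θ) * ∏ i ∈ Finset.range s, (2 + 2 * Real.cos θ - μ i) +
        Real.cos ((m - 1 : ℤ) * θ) * ∏ i ∈ Finset.range s, (2 + 2 * Real.cos θ - μ i)) +
        (2 - μ s) * (Real.cos (m * θ) *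
          ∏ i ∈ Finset.range s, (2 + 2 * Real.cos θ - μ i)) := by
      intro θ
      rw [Finset.prod_range_succ]
      push_cast
      rw [add_mul, sub_mul, one_mul, Real.cos_add, Real.cos_sub]
      ring
    push_cast at hm
    have h1 : |m + 1| ≤ |m| + 1 := by simpa using abs_add_le m 1
    have h2 : |m - 1| ≤ |m| + 1 := by simpa using abs_sub m 1
    simp only [hsplit, fiberSum_add, fiberSum_const_mul]
    rw [ih (m + 1) (by omega) x x', ih (m - 1) (by omega) x x', ih m (by omega) x x']

theorem isNonnegPolyCos_fiberSum_pow {k : ℕ} (hk : 0 < k) (p : ℕ) :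
    IsNonnegPolyCos (fiberSum k fun θ => (2 + 2 * Real.cos θ) ^ p) := by
  obtain ⟨μ, hμ0, hmono, hprod, hnode⟩ := exists_ordered_nodes hk
  have base : ∀ s < k, IsNonnegPolyCos
      (fiberSum k fun θ => ∏ i ∈ Finset.range s, (2 + 2 * Real.cos θ - μ i)) := by
    intro s hs
    have hc : ∀ x, fiberSum k (fun θ => ∏ i ∈ Finset.range s, (2 + 2 * Real.cos θ - μ i)) x =
        fiberSum k (fun θ => ∏ i ∈ Finset.range s, (2 + 2 * Real.cos θ - μ i)) Real.pi := by
      intro x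
      simpa using fiberSum_cos_mul_prod_const μ s 0 (by simpa using hs) x Real.pi
    rw [funext hc]
    refine .const (Finset.sum_nonneg fun j hj => ?_)
    obtain ⟨i, hi, h⟩ := hnode j (by simpa using hj)
    beta_reduce
    rw [h]
    by_cases his : i < s
    · rw [Finset.prod_eq_zero (Finset.mem_range.mpr his) (sub_self _)]
    · refine Finset.prod_nonneg fun t ht => sub_nonneg.mpr (hmono _ _ ?_ hi)
      have := Finset.mem_range.mp ht
      omega
  have main : ∀ p : ℕ, ∀ s < k, IsNonnegPolyCos (fiberSum k fun θ =>
      (2 + 2 * Real.cos θ) ^ p * ∏ i ∈ Finset.range s, (2 + 2 * Real.cos θ - μ i)) := by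
    intro p
    induction p with
    | zero => simpa using base
    | succ p ih =>
      intro s hs
      have hsplit : ∀ θ : ℝ,
          (2 + 2 * Real.cos θ) ^ (p + 1) * ∏ i ∈ Finset.range s, (2 + 2 * Real.cos θ - μ i) =
          (2 + 2 * Real.cos θ) ^ p * ∏ i ∈ Finset.range (s + 1), (2 + 2 * Real.cos θ - μ i) +
          μ s * ((2 + 2 * Real.cos θ) ^ p *
            ∏ i ∈ Finset.range s, (2 + 2 * Real.cos θ - μ i)) := by
        intro θ
        rw [Finset.prod_range_succ]
        ring
      simp only [funext hsplit]
      rw [funext (fiberSum_add k _ _)]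
      refine .add ?_ ?_
      · rcases Nat.lt_or_ge (s + 1) k with h | h
        · exact ih _ h
        · obtain rfl : s + 1 = k := by omega
          have hY : ∀ x, fiberSum (s + 1) (fun θ => (2 + 2 * Real.cos θ) ^ p *
              ∏ i ∈ Finset.range (s + 1), (2 + 2 * Real.cos θ - μ i)) x =
              (2 * (1 + Real.cos x)) * fiberSum (s + 1) (fun θ => (2 + 2 * Real.cos θ) ^ p) x := by
            intro x
            unfold fiberSum
            rw [Finset.mul_sum]
            refine Finset.sum_congr rfl fun j _ => ?_
            beta_reduce
            rw [hprod, mul_div_cancel₀ _ (by positivity), mul_comm (2 * Real.pi),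
              Real.cos_add_nat_mul_two_pi]
            ring
          rw [funext hY]
          refine ((IsNonnegPolyCos.const zero_le_two).mul .one_add_cos).mul ?_
          simpa using ih 0 hk
      · rw [funext (fiberSum_const_mul k _ _)]
        exact (IsNonnegPolyCos.const (hμ0 s)).mul (ih s hs)
  simpa using main p 0 hk

theorem zchoose_sub_natCast (n b : ℕ) : zchoose n ((n : ℤ) - b) = n.choose b := by
  rcases le_or_gt b n with h | h
  · rw [← Nat.cast_sub h, zchoose_natCast, Nat.choose_symm h]
  · rw [zchoose, if_neg (by omega), Nat.choose_eq_zero_of_lt h]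

theorem zchoose_eq_zero {n : ℕ} {b : ℤ} (h : b < 0 ∨ n < b) : zchoose n b = 0 := by
  unfold zchoose
  split_ifs with hb
  · exact Nat.choose_eq_zero_of_lt (by omega)
  · rfl

open Polynomial in
theorem sum_zchoose_mul_cos_eq_coeff (M N R : ℕ) (hR : M + N ≤ R) (θ : ℝ) :
    ∑ m ∈ Finset.Icc (-(R : ℤ)) R, (zchoose (M + N) ((M : ℤ) - m) : ℝ) *
        (zchoose (M + N) ((N : ℤ) - m) : ℝ) * Real.cos (m * θ) =
      (((1 + C (2 * Real.cos (θ / 2)) * X + X ^ 2 : ℝ[X]) ^ (M + N)).coeff (2 * M)) := by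
  set w : ℂ := Complex.exp ((θ / 2 : ℝ) * Complex.I) with hw
  set w' : ℂ := Complex.exp (-((θ / 2 : ℝ) * Complex.I)) with hw'
  have hww : w * w' = 1 := by rw [hw, hw', ← Complex.exp_add]; simp
  have hadd : w + w' = 2 * Complex.cos (θ / 2 : ℝ) := by
    rw [Complex.two_cos, hw, hw', neg_mul]
  have hfac : (1 + C (2 * Real.cos (θ / 2)) * X + X ^ 2 : ℝ[X]).map Complex.ofRealHom =
      (1 + C w * X) * (1 + C w' * X) := by
    have h1 : (C w * C w' : ℂ[X]) = 1 := by rw [← C_mul, hww, C_1]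
    have h2 : (C (2 * Complex.cos (θ / 2 : ℝ)) : ℂ[X]) = C w + C w' := by rw [← hadd, C_add]
    simp only [Polynomial.map_add, Polynomial.map_one, Polynomial.map_mul, map_C, map_X,
      Polynomial.map_pow]
    rw [show Complex.ofRealHom (2 * Real.cos (θ / 2)) = 2 * Complex.cos (θ / 2 : ℝ) by simp, h2]
    linear_combination -X ^ 2 * h1
  have hcoeff : ∀ (v : ℂ) (a : ℕ),
      ((1 + C v * X) ^ (M + N)).coeff a = (M + N).choose a * v ^ a := by
    intro v a
    have : (1 + C v * X) ^ (M + N) = ((1 + X : ℂ[X]) ^ (M + N)).comp (C v * X) := by simp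
    rw [this, comp_C_mul_X_coeff, coeff_one_add_X_pow]
  have hmain : (((1 + C (2 * Real.cos (θ / 2)) * X + X ^ 2 : ℝ[X]) ^ (M + N)).coeff (2 * M)) =
      ∑ p ∈ Finset.HasAntidiagonal.antidiagonal (2 * M),
        ((((M + N).choose p.1 * w ^ p.1) * ((M + N).choose p.2 * w' ^ p.2) : ℂ)).re := by
    rw [← Complex.re_sum]
    simp only [← hcoeff]
    rw [← coeff_mul, ← mul_pow, ← hfac, ← Polynomial.map_pow, coeff_map]
    simp
  rw [hmain]
  symm
  refine Finset.sum_of_injOn (fun p => (M : ℤ) - p.1) ?_ ?_ ?_ ?_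
  · rintro ⟨a, b⟩ h ⟨a', b'⟩ h' he
    simp only [Finset.mem_coe,
      Finset.HasAntidiagonal.mem_antidiagonal] at h h' he
    ext <;> simp only <;> omega
  · rintro ⟨a, b⟩ h
    simp only [Finset.mem_coe, Finset.HasAntidiagonal.mem_antidiagonal] at h
    simp only [Finset.coe_Icc, Set.mem_Icc]
    omega
  · intro m _ hm
    rcases lt_or_ge ((M : ℤ) - m) 0 with h | h
    · rw [zchoose_eq_zero (Or.inl h)]
      simp
    · rcases lt_or_ge (((M + N : ℕ) : ℤ)) (N - m) with h2 | h2
      · rw [zchoose_eq_zero (Or.inr h2)]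
        simp
      · refine absurd ⟨(((M : ℤ) - m).toNat, 2 * M - ((M : ℤ) - m).toNat), ?_, ?_⟩ hm
        · simp only [Finset.mem_coe, Finset.HasAntidiagonal.mem_antidiagonal]
          push_cast at h2
          omega
        · simp only
          omega
  · rintro ⟨a, b⟩ h
    simp only [Finset.HasAntidiagonal.mem_antidiagonal] at h
    rw [show (M : ℤ) - (M - a) = a by ring, zchoose_natCast,
      show (N : ℤ) - (M - a) = (M + N : ℕ) - b by push_cast; omega, zchoose_sub_natCast]
    have hb : (b : ℂ) = 2 * M - a := by
      rw [eq_sub_iff_add_eq, add_comm]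
      exact_mod_cast h
    have hpow : w ^ a * w' ^ b =
        Complex.exp ((-(((M - a : ℤ) : ℝ) * θ) : ℝ) * Complex.I) := by
      rw [hw, hw', ← Complex.exp_nat_mul, ← Complex.exp_nat_mul, ← Complex.exp_add, hb]
      congr 1
      push_cast
      ring
    rw [mul_mul_mul_comm, hpow, ← Nat.cast_mul, ← Complex.ofReal_natCast, Complex.re_ofReal_mul,
      Complex.exp_ofReal_mul_I_re, Real.cos_neg]
    push_cast
    ring

open Polynomial in
theorem exists_coeff_trinomial_pow (n M : ℕ) : ∃ d : ℕ → ℕ, ∀ v : ℝ,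
    ((1 + C v * X + X ^ 2 : ℝ[X]) ^ n).coeff (2 * M) =
      ∑ q ∈ Finset.range (n + 1), (d q : ℝ) * (v ^ 2) ^ (q / 2) := by
  refine ⟨fun q => if q ≤ 2 * M then if 2 ∣ 2 * M - q then
    (n - q).choose ((2 * M - q) / 2) * n.choose q else 0 else 0, fun v => ?_⟩
  rw [show (1 + C v * X + X ^ 2 : ℝ[X]) = C v * X + expand ℝ 2 (1 + X) by simp; ring, add_pow,
    finsetSum_coeff]
  refine Finset.sum_congr rfl fun q _ => ?_
  rw [← map_pow, show ((C v * X) ^ q * expand ℝ 2 ((1 + X) ^ (n - q)) * (n.choose q : ℝ[X])) =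
      C (v ^ q * n.choose q) * (expand ℝ 2 ((1 + X) ^ (n - q)) * X ^ q) by
    rw [mul_pow, C_mul, C_pow, C_eq_natCast]; ring, coeff_C_mul, coeff_mul_X_pow']
  beta_reduce
  by_cases h1 : q ≤ 2 * M
  · rw [if_pos h1, if_pos h1, coeff_expand two_pos]
    by_cases h2 : 2 ∣ 2 * M - q
    · rw [if_pos h2, if_pos h2, coeff_one_add_X_pow, ← pow_mul, show 2 * (q / 2) = q by omega]
      push_cast
      ring
    · simp [h2]
  · simp [h1]

theorem isNonnegPolyCos_sum_zchoose {k : ℕ} (M N : ℕ) (hk : 0 < k) :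
    IsNonnegPolyCos fun x => ∑ l ∈ Finset.Icc (-((M : ℤ) + N)) ((M : ℤ) + N),
      (zchoose (M + N) ((M : ℤ) - k * l) : ℝ) *
        (zchoose (M + N) ((N : ℤ) - k * l) : ℝ) * Real.cos (l * x) := by
  have hk0 : (k : ℝ) ≠ 0 := by positivity
  have hkz : (k : ℤ) ≠ 0 := by exact_mod_cast hk.ne'
  obtain ⟨d, hd⟩ := exists_coeff_trinomial_pow (M + N) M
  let c : ℤ → ℝ := fun m => (zchoose (M + N) ((M : ℤ) - m) : ℝ) *
    (zchoose (M + N) ((N : ℤ) - m) : ℝ)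
  have hF : ∀ θ : ℝ, ∑ m ∈ Finset.Icc (-((k * (M + N) : ℕ) : ℤ)) ((k * (M + N) : ℕ) : ℤ),
      c m * Real.cos (m * θ) =
      ∑ q ∈ Finset.range (M + N + 1), (d q : ℝ) * (2 + 2 * Real.cos θ) ^ (q / 2) := by
    intro θ
    rw [sum_zchoose_mul_cos_eq_coeff M N _ (Nat.le_mul_of_pos_left _ hk), hd]
    have : (2 * Real.cos (θ / 2)) ^ 2 = 2 + 2 * Real.cos θ := by
      rw [mul_pow, Real.cos_sq, mul_div_cancel₀ _ two_ne_zero]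
      ring
    rw [this]
  have hfold : ∀ x : ℝ, ∑ l ∈ Finset.Icc (-((M : ℤ) + N)) ((M : ℤ) + N),
      c (k * l) * Real.cos (l * x) = (k : ℝ)⁻¹ * ∑ q ∈ Finset.range (M + N + 1),
        (d q : ℝ) * fiberSum k (fun θ => (2 + 2 * Real.cos θ) ^ (q / 2)) x := by
    intro x
    simp only [← fiberSum_const_mul k (d _ : ℝ)]
    rw [← fiberSum_sum, ← funext hF, fiberSum_sum, Finset.mul_sum]
    simp only [fiberSum_const_mul, fiberSum_cos hk]
    refine Finset.sum_of_injOn (fun l => k * l) ?_ ?_ ?_ ?_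
    · intro a _ b _ hab
      exact mul_left_cancel₀ hkz hab
    · intro l hl
      simp only [Finset.coe_Icc, Set.mem_Icc] at hl ⊢
      push_cast
      constructor <;> nlinarith
    · intro m hm hnot
      rw [if_neg, mul_zero, mul_zero]
      rintro ⟨l, rfl⟩
      refine hnot ⟨l, ?_, rfl⟩
      simp only [Finset.coe_Icc, Finset.mem_Icc, Set.mem_Icc] at hm ⊢
      push_cast at hm
      have hkp : (0 : ℤ) < k := by exact_mod_cast hk
      constructor <;> nlinarith
    · intro l _
      rw [if_pos (dvd_mul_right _ _), Int.mul_ediv_cancel_left _ hkz]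
      field_simp
  refine (funext hfold) ▸ (IsNonnegPolyCos.const (by positivity)).mul
    (.sum _ fun q _ => (IsNonnegPolyCos.const (by positivity)).mul
      (isNonnegPolyCos_fiberSum_pow hk _))

open Polynomial in
/-- An integral polynomial in `1 + cos x` that has nonnegative real coefficients as such has
natural number coefficients. -/
theorem IsNonnegPolyCos.exists_nat_coeff {h : ℝ → ℝ} (hh : IsNonnegPolyCos h) (Q : ℤ[X])
    (hQ : ∀ x, h x = (Q.map (Int.castRingHom ℝ)).eval (1 + Real.cos x)) :
    ∃ (m : ℕ) (a : ℕ → ℕ), ∀ x : ℝ,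
      h x = ∑ p ∈ Finset.range (m + 1), (a p : ℝ) * (1 + Real.cos x) ^ p := by
  obtain ⟨R, hR, hhR⟩ := hh
  have hRQ : R = Q.map (Int.castRingHom ℝ) := by
    refine eq_of_infinite_eval_eq _ _ ((Set.Icc_infinite zero_lt_one).mono fun c hc => ?_)
    have hcos : 1 + Real.cos (Real.arccos (c - 1)) = c := by
      rw [Real.cos_arccos (by linarith [hc.1]) (by linarith [hc.2])]
      ring
    have := hhR (Real.arccos (c - 1))
    rwa [hQ, hcos, eq_comm] at this
  refine ⟨R.natDegree, fun p => (Q.coeff p).toNat, fun x => ?_⟩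
  rw [hhR, eval_eq_sum_range]
  refine Finset.sum_congr rfl fun p _ => ?_
  have hp : R.coeff p = (Q.coeff p : ℝ) := by rw [hRQ, coeff_map]; rfl
  have hp0 : 0 ≤ Q.coeff p := by exact_mod_cast hp ▸ hR p
  rw [hp, ← Int.cast_natCast, Int.toNat_of_nonneg hp0]

theorem stmt3 (k M N : ℕ) (hk : 0 < k) :
    ∃ (m : ℕ) (a : ℕ → ℕ), ∀ x : ℝ,
      ∑ l ∈ Finset.Icc (-((M : ℤ) + N)) ((M : ℤ) + N),
        (zchoose (M + N) ((M : ℤ) - k * l) : ℝ) *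
          (zchoose (M + N) ((N : ℤ) - k * l) : ℝ) * Real.cos (l * x)
      = ∑ p ∈ Finset.range (m + 1), (a p : ℝ) * (1 + Real.cos x) ^ p := by
  refine (isNonnegPolyCos_sum_zchoose M N hk).exists_nat_coeff
    (∑ l ∈ Finset.Icc (-((M : ℤ) + N)) ((M : ℤ) + N),
      ((zchoose (M + N) ((M : ℤ) - k * l) * zchoose (M + N) ((N : ℤ) - k * l) : ℕ) :
        Polynomial ℤ) * (Polynomial.Chebyshev.T ℤ l).comp (Polynomial.X - 1)) fun x => ?_
  rw [Polynomial.map_sum, Polynomial.eval_finsetSum]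
  refine Finset.sum_congr rfl fun l _ => ?_
  simp [Polynomial.map_comp, Polynomial.Chebyshev.map_T]
end

section
/- Let k be a positive integer and let M, N be nonnegative integers with |M − N| ≤ k. Then the number of pairs (u, v) of binary words of length M + N, where u has exactly M ones and N zeros, v has exactly N ones and M zeros, and such that −k < ∑_{j=1}^{s} (u_j − v_j) < k for every s with 1 ≤ s ≤ M + N, equals ∑_{l ∈ ℤ} (−1)^l · C(M+N, M−kl)^2. -/
/-- The number of ones in a binary word of length `n`. -/
def ones {n : ℕ} (u : Fin n → Bool) : ℕ := (Finset.univ.filter fun j => u j = true).card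

/-- The partial sum `d_s = ∑_{j=1}^{s} (u_j - v_j)` (computed in `ℤ`). -/
def dval {n : ℕ} (u v : Fin n → Bool) (s : ℕ) : ℤ :=
  ∑ j ∈ Finset.univ.filter (fun j : Fin n => (j : ℕ) < s),
    ((if u j then 1 else 0) - (if v j then 1 else 0) : ℤ)

theorem zchoose_succ (n : ℕ) (b : ℤ) :
    zchoose (n + 1) b = zchoose n b + zchoose n (b - 1) := by
  rcases lt_trichotomy b 0 with hb | rfl | hb
  · simp [zchoose, show ¬ 0 ≤ b by omega, show ¬ 1 ≤ b by omega]
  · simp [zchoose]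
  · obtain ⟨m, rfl⟩ : ∃ m : ℕ, b = m + 1 := ⟨(b - 1).toNat, by omega⟩
    have h1 : ((m : ℤ) + 1).toNat = m + 1 := by omega
    simp [zchoose, h1, show (0 : ℤ) ≤ m + 1 by omega, Nat.choose_succ_succ, add_comm]

theorem zchoose_zero (b : ℤ) : zchoose 0 b = if b = 0 then 1 else 0 := by
  rcases lt_trichotomy b 0 with hb | rfl | hb
  · simp [zchoose, show ¬ 0 ≤ b by omega, hb.ne]
  · simp [zchoose]
  · obtain ⟨m, rfl⟩ : ∃ m : ℕ, b = m + 1 := ⟨(b - 1).toNat, by omega⟩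
    have h1 : ((m : ℤ) + 1).toNat = m + 1 := by omega
    simp [zchoose, h1, show (m : ℤ) + 1 ≠ 0 by omega]

theorem zchoose_bounds {n : ℕ} {b : ℤ} (h : zchoose n b ≠ 0) : 0 ≤ b ∧ b ≤ n := by
  unfold zchoose at h
  split_ifs at h with hb
  · refine ⟨hb, ?_⟩
    by_contra hlt
    exact h (Nat.choose_eq_zero_of_lt (by omega))
  · exact absurd rfl h

/-- The `l`-th term of the signed sum over reflections of the endpoint `(x, y)`. -/
def reflectTerm (k n : ℕ) (x y l : ℤ) : ℤ :=
  (-1) ^ l.natAbs * (zchoose n (x - k * l) * zchoose n (y + k * l))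

/-- The signed sum, over the reflections of the endpoint `(x, y)`, of the number of pairs of words
of length `n` with these numbers of ones. -/
noncomputable def reflectSum (k n : ℕ) (x y : ℤ) : ℤ := ∑ᶠ l : ℤ, reflectTerm k n x y l

theorem reflectTerm_bounds {k n : ℕ} {x y l : ℤ} (h : reflectTerm k n x y l ≠ 0) :
    0 ≤ x - k * l ∧ x - k * l ≤ n := by
  refine zchoose_bounds fun h0 => h ?_
  simp [reflectTerm, h0]

theorem reflectTerm_support_finite {k : ℕ} (hk : 0 < k) (n : ℕ) (x y : ℤ) :
    (Function.support (reflectTerm k n x y)).Finite := by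
  refine (Set.finite_Icc (-(|x| + n)) (|x| + n)).subset fun l hl => ?_
  obtain ⟨h1, h2⟩ := reflectTerm_bounds hl
  have hk' : (1 : ℤ) ≤ k := by exact_mod_cast hk
  have := le_abs_self x
  have := neg_abs_le x
  have := abs_nonneg x
  constructor <;> nlinarith

theorem reflectSum_succ {k : ℕ} (hk : 0 < k) (n : ℕ) (x y : ℤ) :
    reflectSum k (n + 1) x y = reflectSum k n (x - 1) (y - 1) + reflectSum k n (x - 1) y
      + (reflectSum k n x (y - 1) + reflectSum k n x y) := by
  have fin := reflectTerm_support_finite hk n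
  unfold reflectSum
  rw [← finsum_add_distrib (fin _ _) (fin _ _), ← finsum_add_distrib (fin _ _) (fin _ _),
    ← finsum_add_distrib (((fin _ _).union (fin _ _)).subset (Function.support_add _ _))
      (((fin _ _).union (fin _ _)).subset (Function.support_add _ _))]
  refine finsum_congr fun l => ?_
  simp only [reflectTerm, zchoose_succ]
  rw [show x - 1 - k * l = x - k * l - 1 by ring, show y - 1 + k * l = y + k * l - 1 by ring]
  push_cast
  ring

theorem neg_one_pow_natAbs_sub {c : ℤ} (hc : Odd c) (l : ℤ) :
    (-1 : ℤ) ^ (c - l).natAbs = -(-1) ^ l.natAbs := by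
  rcases Int.even_or_odd l with hl | hl
  · rw [(Int.natAbs_odd.2 (hc.sub_even hl)).neg_one_pow, (Int.natAbs_even.2 hl).neg_one_pow]
  · rw [(Int.natAbs_even.2 (hc.sub_odd hl)).neg_one_pow, (Int.natAbs_odd.2 hl).neg_one_pow, neg_neg]

theorem reflectSum_eq_zero (k n : ℕ) {x y c : ℤ} (hc : Odd c) (h : x - y = k * c) :
    reflectSum k n x y = 0 := by
  have key : reflectSum k n x y = -reflectSum k n x y := by
    unfold reflectSum
    rw [← finsum_neg_distrib, ← finsum_comp_equiv (Equiv.subLeft c)]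
    refine finsum_congr fun l => ?_
    simp only [reflectTerm, Equiv.subLeft_apply, neg_one_pow_natAbs_sub hc]
    rw [show x - k * (c - l) = y + k * l by linear_combination h,
      show y + k * (c - l) = x - k * l by linear_combination -h]
    ring
  omega

theorem reflectSum_zero {k : ℕ} (hk : 0 < k) {x y : ℤ} (h : |x - y| ≤ k) :
    reflectSum k 0 x y = if x = 0 ∧ y = 0 then 1 else 0 := by
  unfold reflectSum
  rw [finsum_eq_single _ 0]
  · by_cases hx : x = 0 <;> by_cases hy : y = 0 <;> simp [reflectTerm, zchoose_zero, hx, hy]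
  · intro l hl
    simp only [reflectTerm, zchoose_zero]
    by_contra hne
    have hx : x - k * l = 0 := by by_contra hx; simp [hx] at hne
    have hy : y + k * l = 0 := by by_contra hy; simp [hy] at hne
    have hk' : (1 : ℤ) ≤ k := by exact_mod_cast hk
    rw [abs_le] at h
    rcases lt_or_gt_of_ne hl with hl | hl <;> nlinarith

theorem ones_snoc {n : ℕ} (u : Fin n → Bool) (a : Bool) :
    (ones (Fin.snoc u a : Fin (n + 1) → Bool) : ℤ) = ones u + if a then 1 else 0 := by
  simp only [ones, Finset.card_filter, Fin.sum_univ_castSucc, Fin.snoc_castSucc, Fin.snoc_last]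
  push_cast
  rfl

theorem dval_snoc {n : ℕ} (u v : Fin n → Bool) (a b : Bool) {s : ℕ} (hs : s ≤ n) :
    dval (Fin.snoc u a : Fin (n + 1) → Bool) (Fin.snoc v b : Fin (n + 1) → Bool) s
      = dval u v s := by
  simp only [dval, Finset.sum_filter, Fin.sum_univ_castSucc, Fin.snoc_castSucc, Fin.snoc_last]
  simp [hs]

theorem dval_self {n : ℕ} (u v : Fin n → Bool) : dval u v n = (ones u : ℤ) - ones v := by
  simp [dval, ones, Finset.sum_sub_distrib]

/-- The words `u` and `v` have `x` and `y` ones, and their partial sums stay in `(-k, k)`. -/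
def IsConfined (k : ℕ) {n : ℕ} (x y : ℤ) (u v : Fin n → Bool) : Prop :=
  (ones u : ℤ) = x ∧ (ones v : ℤ) = y ∧
    ∀ s ∈ Finset.Icc 1 n, -(k : ℤ) < dval u v s ∧ dval u v s < k

theorem isConfined_snoc (k : ℕ) {n : ℕ} (x y : ℤ) (u v : Fin n → Bool) (a b : Bool) :
    IsConfined k x y (Fin.snoc u a : Fin (n + 1) → Bool) (Fin.snoc v b : Fin (n + 1) → Bool) ↔
      |x - y| < k ∧ IsConfined k (x - if a then 1 else 0) (y - if b then 1 else 0) u v := by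
  unfold IsConfined
  rw [← Finset.insert_Icc_right_eq_Icc_add_one (by omega), Finset.forall_mem_insert, dval_self,
    ones_snoc, ones_snoc, abs_lt]
  have : (∀ s ∈ Finset.Icc 1 n, -(k : ℤ) < dval (Fin.snoc u a : Fin (n + 1) → Bool)
      (Fin.snoc v b : Fin (n + 1) → Bool) s ∧ dval (Fin.snoc u a : Fin (n + 1) → Bool)
      (Fin.snoc v b : Fin (n + 1) → Bool) s < k) ↔
      ∀ s ∈ Finset.Icc 1 n, -(k : ℤ) < dval u v s ∧ dval u v s < k :=
    forall₂_congr fun s hs => by rw [dval_snoc u v a b (Finset.mem_Icc.1 hs).2]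
  rw [this]
  constructor
  · rintro ⟨h1, h2, h3, h4⟩
    exact ⟨by omega, by omega, by omega, h4⟩
  · rintro ⟨h1, h2, h3, h4⟩
    exact ⟨by omega, by omega, by omega, h4⟩

theorem sum_boolWord_succ {R : Type*} [AddCommMonoid R] {n : ℕ} (g : (Fin (n + 1) → Bool) → R) :
    ∑ u, g u = ∑ u : Fin n → Bool, g (Fin.snoc u true) +
      ∑ u : Fin n → Bool, g (Fin.snoc u false) := by
  rw [← (Fin.snocEquiv fun _ => Bool).sum_comp, Fintype.sum_prod_type, Fintype.sum_bool]
  rfl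

open scoped Classical in
theorem sum_isConfined {k : ℕ} (hk : 0 < k) (n : ℕ) {x y : ℤ} (h : |x - y| ≤ k) :
    ∑ u : Fin n → Bool, ∑ v : Fin n → Bool, (if IsConfined k x y u v then (1 : ℤ) else 0)
      = reflectSum k n x y := by
  induction n generalizing x y with
  | zero =>
    rw [reflectSum_zero hk h]
    simp [IsConfined, ones, @eq_comm ℤ 0]
  | succ n ih =>
    simp only [sum_boolWord_succ, Finset.sum_add_distrib, isConfined_snoc]
    rcases h.lt_or_eq with hlt | heq
    · rw [reflectSum_succ hk]
      rw [abs_lt] at hlt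
      rw [← ih (x := x - 1) (y := y - 1) (by rw [abs_le]; omega),
        ← ih (x := x - 1) (y := y) (by rw [abs_le]; omega),
        ← ih (x := x) (y := y - 1) (by rw [abs_le]; omega), ← ih h]
      simp [abs_lt.2 hlt]
      ring
    · have : reflectSum k (n + 1) x y = 0 := by
        rcases abs_eq (by omega : (0 : ℤ) ≤ k) |>.1 heq with h1 | h1
        · exact reflectSum_eq_zero k _ odd_one (by rw [h1]; ring)
        · exact reflectSum_eq_zero k _ odd_neg_one (by rw [h1]; ring)
      simp [this, heq]

open scoped Classical in
theorem stmt4 (k M N : ℕ) (hk : 0 < k) (h : |(M : ℤ) - N| ≤ k) :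
    ((Finset.univ.filter fun uv : (Fin (M + N) → Bool) × (Fin (M + N) → Bool) =>
        ones uv.1 = M ∧ ones uv.2 = N ∧
        ∀ s ∈ Finset.Icc 1 (M + N),
          -(k : ℤ) < dval uv.1 uv.2 s ∧ dval uv.1 uv.2 s < k).card : ℤ)
    = ∑ l ∈ Finset.Icc (-((M : ℤ) + N)) ((M : ℤ) + N),
        (-1 : ℤ) ^ l.natAbs * (zchoose (M + N) ((M : ℤ) - k * l) : ℤ) ^ 2 := by
  have hsum := sum_isConfined hk (M + N) h
  rw [← Fintype.sum_prod_type'] at hsum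
  have hcard : ∀ uv : (Fin (M + N) → Bool) × (Fin (M + N) → Bool),
      (ones uv.1 = M ∧ ones uv.2 = N ∧ ∀ s ∈ Finset.Icc 1 (M + N),
        -(k : ℤ) < dval uv.1 uv.2 s ∧ dval uv.1 uv.2 s < k) ↔
      IsConfined k M N uv.1 uv.2 := fun uv => by simp only [IsConfined, Nat.cast_inj]
  simp only [hcard, Finset.card_filter, Nat.cast_sum, Nat.cast_ite, Nat.cast_one, Nat.cast_zero]
  rw [hsum, reflectSum, finsum_eq_sum_of_support_subset (s := Finset.Icc (-((M : ℤ) + N)) (M + N))]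
  · refine Finset.sum_congr rfl fun l _ => ?_
    rw [reflectTerm, show (N : ℤ) + k * l = (M + N : ℕ) - (M - k * l) by push_cast; ring,
      zchoose_symm, sq]
  · intro l hl
    obtain ⟨h1, h2⟩ := reflectTerm_bounds hl
    have hk' : (1 : ℤ) ≤ k := by exact_mod_cast hk
    push_cast at h2
    rw [Finset.coe_Icc]
    constructor <;> nlinarith
end

section
/- Let k be a positive integer and let M, N be nonnegative integers with |M − N| ≤ k. For each nonnegative integer p, let b_p be the number of pairs (u, v) of binary words of length M + N, where u has exactly M ones and N zeros, v has exactly N ones and M zeros, such that (u, v) is of class p with respect to k and moreover −2k < d_s < 2k for every s with 1 ≤ s ≤ M + N, where d_s = ∑_{j=1}^{s} (u_j − v_j). Then for every real number x, ∑_{l ∈ ℤ} C(M+N, M−kl)^2 · cos(l·x) = ∑_{p ≥ 0} b_p · (1 + cos x)^p (the sum over p is finite since b_p = 0 for all large p). -/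
/-- The list of cut positions starting from position `t`: the next cut is the least
`s` with `t < s ≤ n` and `|d s − d t| = k`.  The `fuel` argument (taken `≥ n`)
guarantees termination; since each cut position strictly increases, fuel `n + 1`
produces all cut positions. -/
def cutList (k n : ℕ) (d : ℕ → ℤ) : ℕ → ℕ → List ℕ
  | 0, _ => []
  | fuel + 1, t =>
    let S := (Finset.Ioc t n).filter fun s => (d s - d t).natAbs = k
    if h : S.Nonempty then S.min' h :: cutList k n d fuel (S.min' h)
    else []

/-- The class of a pair of words with partial-sum sequence `d` (with respect to `k`):
the number of cut positions `t` with `d t = k` or `d t = −k`. -/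
def classOf (k n : ℕ) (d : ℕ → ℤ) : ℕ :=
  ((cutList k n d (n + 1) 0).filter fun t => decide (d t = (k : ℤ) ∨ d t = -(k : ℤ))).length

lemma sum_word_succ {r : ℕ} (f : (Fin (r + 1) → Bool) → ℝ) :
    ∑ u, f u = ∑ i : Bool, ∑ u : Fin r → Bool, f (Fin.cons i u) := by
  rw [← Fintype.sum_prod_type']
  exact (Fintype.sum_equiv (Fin.consEquiv fun _ => Bool) _ _ fun _ => rfl).symm

lemma ones_cons {r : ℕ} (i : Bool) (u : Fin r → Bool) :
    ones (Fin.cons i u : Fin (r + 1) → Bool) = i.toNat + ones u := by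
  simp only [ones, Finset.card_filter, Fin.sum_univ_succ, Fin.cons_zero, Fin.cons_succ]
  cases i <;> simp

lemma dval_zero {r : ℕ} (u v : Fin r → Bool) : dval u v 0 = 0 := by
  simp [dval]

lemma dval_cons_succ {r : ℕ} (i j : Bool) (u v : Fin r → Bool) (s : ℕ) :
    dval (Fin.cons i u : Fin (r + 1) → Bool) (Fin.cons j v : Fin (r + 1) → Bool) (s + 1)
      = i.toNat - j.toNat + dval u v s := by
  simp only [dval, Finset.sum_filter, Fin.sum_univ_succ, Fin.cons_zero, Fin.cons_succ]
  cases i <;> cases j <;> simp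

lemma dval_length {n : ℕ} (u v : Fin n → Bool) : dval u v n = ones u - ones v := by
  simp [dval, ones, Finset.sum_sub_distrib]

/-- Sum of a function of the number of ones over all words. -/
lemma sum_word_ones (n : ℕ) (g : ℕ → ℝ) :
    ∑ u : Fin n → Bool, g (ones u) = ∑ i ∈ Finset.range (n + 1), (n.choose i : ℝ) * g i := by
  have h := Finset.sum_powerset_apply_card (x := (Finset.univ : Finset (Fin n))) g
  simp only [Finset.card_univ, Fintype.card_fin, nsmul_eq_mul, Finset.powerset_univ] at h
  rw [← h]
  refine Finset.sum_bij' (fun u _ => Finset.univ.filter fun j => u j = true)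
    (fun s _ j => decide (j ∈ s)) ?_ ?_ ?_ ?_ ?_ <;> simp [ones]

/-- Cut positions produced by reading the path one step at a time: `s` is the current position,
`t` the last cut, and the first argument the number of steps left. -/
def scanCuts (k : ℕ) (d : ℕ → ℤ) : ℕ → ℕ → ℕ → List ℕ
  | 0, _, _ => []
  | r + 1, s, t =>
    if (d (s + 1) - d t).natAbs = k then (s + 1) :: scanCuts k d r (s + 1) (s + 1)
    else scanCuts k d r (s + 1) t

lemma length_scanCuts_le (k : ℕ) (d : ℕ → ℤ) (r s t : ℕ) : (scanCuts k d r s t).length ≤ r := by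
  induction r generalizing s t with
  | zero => simp [scanCuts]
  | succ r ih =>
    rw [scanCuts]
    split_ifs
    · simpa using ih (s + 1) (s + 1)
    · exact (ih (s + 1) t).trans (Nat.le_succ r)

lemma cutList_eq_scanCuts (k : ℕ) (d : ℕ → ℤ) (r s t fuel : ℕ) (hts : t ≤ s)
    (hfuel : s + r - t < fuel) (hmiss : ∀ s', t < s' → s' ≤ s → (d s' - d t).natAbs ≠ k) :
    cutList k (s + r) d fuel t = scanCuts k d r s t := by
  induction r generalizing s t fuel with
  | zero =>
    obtain ⟨f, rfl⟩ : ∃ f, fuel = f + 1 := ⟨fuel - 1, by omega⟩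
    rw [cutList, scanCuts, dif_neg]
    rintro ⟨s', hs'⟩
    rw [Finset.mem_filter, Finset.mem_Ioc] at hs'
    exact hmiss s' hs'.1.1 hs'.1.2 hs'.2
  | succ r ih =>
    rw [scanCuts]
    have e : s + (r + 1) = s + 1 + r := by omega
    rw [e] at hfuel ⊢
    split_ifs with hit
    · obtain ⟨f, rfl⟩ : ∃ f, fuel = f + 1 := ⟨fuel - 1, by omega⟩
      have mem : s + 1 ∈ (Finset.Ioc t (s + 1 + r)).filter
          fun s' => (d s' - d t).natAbs = k := by
        rw [Finset.mem_filter, Finset.mem_Ioc]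
        exact ⟨by omega, hit⟩
      have hmin : ((Finset.Ioc t (s + 1 + r)).filter
          fun s' => (d s' - d t).natAbs = k).min' ⟨_, mem⟩ = s + 1 := by
        refine le_antisymm (Finset.min'_le _ _ mem) (Finset.le_min' _ _ _ fun s' hs' => ?_)
        rw [Finset.mem_filter, Finset.mem_Ioc] at hs'
        by_contra hlt
        exact hmiss s' hs'.1.1 (by omega) hs'.2
      rw [cutList, dif_pos ⟨_, mem⟩, hmin, ih (s + 1) (s + 1) f le_rfl (by omega)]
      intro s' h1 h2
      omega
    · refine ih (s + 1) t fuel (by omega) hfuel fun s' h1 h2 => ?_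
      rcases Nat.lt_or_ge s s' with h3 | h3
      · obtain rfl : s' = s + 1 := by omega
        exact hit
      · exact hmiss s' h1 h3

lemma classOf_eq (k n : ℕ) (d : ℕ → ℤ) :
    classOf k n d =
      ((scanCuts k d n 0 0).filter fun t => decide (d t = (k : ℤ) ∨ d t = -(k : ℤ))).length := by
  have h := cutList_eq_scanCuts k d n 0 0 (n + 1) le_rfl (by omega) (by omega)
  rw [Nat.zero_add] at h
  rw [classOf, h]

/-- Effect on a weight `F` (a function of the last cut value) of stepping to `z` when the last
cut value is `a`: leaving `(-2k, 2k)` kills the path, and a new cut at `±k` contributes `q`. -/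
def stepWeight (k : ℕ) (q : ℝ) (a z : ℤ) (F : ℤ → ℝ) : ℝ :=
  if -(2 * k : ℤ) < z ∧ z < 2 * k then
    if (z - a).natAbs = k then (if z = (k : ℤ) ∨ z = -(k : ℤ) then q else 1) * F z else F a
  else 0

lemma stepWeight_sum {ι : Type*} (S : Finset ι) (k : ℕ) (q : ℝ) (a z : ℤ) (F : ι → ℤ → ℝ) :
    ∑ i ∈ S, stepWeight k q a z (F i) = stepWeight k q a z fun a' => ∑ i ∈ S, F i a' := by
  unfold stepWeight
  split_ifs <;> simp [Finset.mul_sum]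

lemma stepWeight_ite (p : Prop) [Decidable p] (k : ℕ) (q : ℝ) (a z : ℤ) (F : ℤ → ℝ) :
    (if p then stepWeight k q a z F else 0)
      = stepWeight k q a z fun a' => if p then F a' else 0 := by
  unfold stepWeight
  split_ifs <;> simp

/-- Weight of the last `r` steps of a path `d`, from position `s`, with last cut value `a`. -/
def pathWeight (k : ℕ) (c : ℤ) (q : ℝ) (d : ℕ → ℤ) : ℕ → ℕ → ℤ → ℝ
  | 0, s, _ => if d s = c then 1 else 0
  | r + 1, s, a => stepWeight k q a (d (s + 1)) fun a' => pathWeight k c q d r (s + 1) a'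

lemma pathWeight_shift (k : ℕ) (c : ℤ) (q : ℝ) (d : ℕ → ℤ) (r s : ℕ) (a : ℤ) :
    pathWeight k c q d r (s + 1) a = pathWeight k c q (fun i => d (i + 1)) r s a := by
  induction r generalizing s a with
  | zero => rfl
  | succ r ih => simp only [pathWeight, ih]

open scoped Classical in
lemma pathWeight_eq (k : ℕ) (c : ℤ) (q : ℝ) (d : ℕ → ℤ) (r s t : ℕ) :
    pathWeight k c q d r s (d t) =
      if (∀ i ∈ Finset.Ioc s (s + r), -(2 * k : ℤ) < d i ∧ d i < 2 * k) ∧ d (s + r) = c then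
        q ^ ((scanCuts k d r s t).filter
          fun t => decide (d t = (k : ℤ) ∨ d t = -(k : ℤ))).length
      else 0 := by
  induction r generalizing s t with
  | zero => simp [pathWeight, scanCuts]
  | succ r ih =>
    have e : s + (r + 1) = s + 1 + r := by omega
    have hIoc : (∀ i ∈ Finset.Ioc s (s + 1 + r), -(2 * k : ℤ) < d i ∧ d i < 2 * k) ↔
        (-(2 * k : ℤ) < d (s + 1) ∧ d (s + 1) < 2 * k) ∧
          ∀ i ∈ Finset.Ioc (s + 1) (s + 1 + r), -(2 * k : ℤ) < d i ∧ d i < 2 * k := by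
      have : Finset.Ioc s (s + 1 + r) = insert (s + 1) (Finset.Ioc (s + 1) (s + 1 + r)) := by
        ext i
        simp only [Finset.mem_Ioc, Finset.mem_insert]
        omega
      rw [this, Finset.forall_mem_insert]
    simp only [pathWeight, stepWeight, e, hIoc, scanCuts]
    by_cases hz : -(2 * k : ℤ) < d (s + 1) ∧ d (s + 1) < 2 * k
    · rw [if_pos hz]
      by_cases hit : (d (s + 1) - d t).natAbs = k
      · rw [if_pos hit, if_pos hit, ih (s + 1) (s + 1), List.filter_cons]
        by_cases hk : d (s + 1) = (k : ℤ) ∨ d (s + 1) = -(k : ℤ)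
        · simp only [hz, hk, true_and, and_self, if_true, decide_true, List.length_cons,
            pow_succ', mul_ite, mul_zero]
        · simp only [hz, hk, true_and, and_self, if_false, decide_false, one_mul,
            Bool.false_eq_true]
      · rw [if_neg hit, if_neg hit, ih (s + 1) t]
        simp only [hz, true_and, and_self]
    · rw [if_neg hz, if_neg fun h => hz h.1.1]

/-- The factor `cos (l x)` attached to the final value `z = c - 2kl`, zero for other `z`. -/
noncomputable def endWeight (k : ℕ) (c : ℤ) (x : ℝ) (z : ℤ) : ℝ :=
  if (2 * k : ℤ) ∣ c - z then Real.cos (((c - z) / (2 * k) : ℤ) * x) else 0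

lemma endWeight_of_eq {k : ℕ} (hk : 0 < k) {c : ℤ} (x : ℝ) {z : ℤ} (l : ℤ)
    (hz : c - z = 2 * k * l) : endWeight k c x z = Real.cos (l * x) := by
  have h2 : (2 * k : ℤ) ≠ 0 := by omega
  rw [endWeight, hz, if_pos (dvd_mul_right _ _), Int.mul_ediv_cancel_left _ h2]

lemma endWeight_of_lt {k : ℕ} {c : ℤ} (x : ℝ) {z : ℤ} (l : ℤ)
    (h1 : 2 * k * l < c - z) (h2 : c - z < 2 * k * (l + 1)) : endWeight k c x z = 0 := by
  rw [endWeight, if_neg]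
  rintro ⟨m, hm⟩
  rw [hm] at h1 h2
  have h3 := lt_of_mul_lt_mul_left h1 (by positivity)
  have h4 := lt_of_mul_lt_mul_left h2 (by positivity)
  omega

lemma endWeight_add_sub {k : ℕ} (hk : 0 < k) (c : ℤ) (x : ℝ) (z : ℤ) :
    endWeight k c x (z + 2 * k) + endWeight k c x (z - 2 * k)
      = 2 * Real.cos x * endWeight k c x z := by
  by_cases hd : (2 * k : ℤ) ∣ c - z
  · obtain ⟨l, hl⟩ := hd
    rw [endWeight_of_eq hk x l hl, endWeight_of_eq hk x (l - 1) (by linear_combination hl),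
      endWeight_of_eq hk x (l + 1) (by linear_combination hl)]
    push_cast
    rw [sub_mul, add_mul, one_mul, Real.cos_sub, Real.cos_add]
    ring
  · have h1 : ¬ (2 * k : ℤ) ∣ c - (z + 2 * k) := fun h => hd <| by
      simpa [← sub_sub] using (dvd_add_self_right).2 h
    have h2 : ¬ (2 * k : ℤ) ∣ c - (z - 2 * k) := fun h => hd <| by
      have := dvd_sub_self_right.2 h
      rwa [show c - (z - 2 * k) - 2 * (k : ℤ) = c - z by ring] at this
    rw [endWeight, endWeight, endWeight, if_neg h1, if_neg h2, if_neg hd]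
    ring

lemma endWeight_near_zero {k : ℕ} (hk : 0 < k) {c : ℤ} (hc : |c| ≤ k) (x : ℝ) {y : ℤ}
    (hy : |y| < k) : endWeight k c x y = if y = c then 1 else 0 := by
  rw [abs_le] at hc
  rw [abs_lt] at hy
  split_ifs with h
  · rw [endWeight_of_eq hk x 0 (by rw [h]; ring)]
    simp
  · rcases lt_or_gt_of_ne h with h | h
    · exact endWeight_of_lt x 0 (by omega) (by omega)
    · exact endWeight_of_lt x (-1) (by omega) (by omega)

lemma endWeight_near_cut {k : ℕ} (hk : 0 < k) {c : ℤ} (hc : |c| ≤ k) (x : ℝ) {y : ℤ}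
    (hy : |y| < k) :
    endWeight k c x (k + y) + endWeight k c x (-k + y)
      = (1 + Real.cos x) *
        ((if (k : ℤ) + y = c then 1 else 0) + if -(k : ℤ) + y = c then 1 else 0) := by
  rw [abs_le] at hc
  rw [abs_lt] at hy
  by_cases h1 : (k : ℤ) + y = c
  · rw [if_pos h1, if_neg (by omega), endWeight_of_eq hk x 0 (by rw [h1]; ring),
      endWeight_of_eq hk x 1 (by linarith)]
    simp
  by_cases h2 : -(k : ℤ) + y = c
  · rw [if_pos h2, if_neg (by omega), endWeight_of_eq hk x 0 (z := -(k : ℤ) + y) (by rw [h2]; ring),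
      endWeight_of_eq hk x (-1) (by linarith)]
    simp [add_comm]
  rw [if_neg h1, if_neg h2, add_zero, mul_zero]
  rcases lt_or_gt_of_ne h1 with h1 | h1 <;> rcases lt_or_gt_of_ne h2 with h2 | h2
  · rw [endWeight_of_lt x 0 (by omega) (by omega), endWeight_of_lt x 1 (by omega) (by omega),
      add_zero]
  · omega
  · rw [endWeight_of_lt x (-1) (by omega) (by omega), endWeight_of_lt x 0 (by omega) (by omega),
      add_zero]
  · rw [endWeight_of_lt x (-2) (by omega) (by omega),
      endWeight_of_lt x (-1) (by omega) (by omega), add_zero]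

/-- Total end weight of the pairs of words of length `r`, started at difference `z` and number of
ones `w`, whose final number of ones is `n`. -/
noncomputable def freeSum (k : ℕ) (c : ℤ) (x : ℝ) (n r : ℕ) (z : ℤ) (w : ℕ) : ℝ :=
  ∑ u : Fin r → Bool, ∑ v : Fin r → Bool,
    if w + ones u + ones v = n then endWeight k c x (z + ones u - ones v) else 0

/-- Total path weight of the pairs of words of length `r`, started at difference `z`, number of
ones `w` and last cut value `a`, whose final number of ones is `n`. -/
noncomputable def confinedSum (k : ℕ) (c : ℤ) (q : ℝ) (n r : ℕ) (z : ℤ) (w : ℕ) (a : ℤ) : ℝ :=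
  ∑ u : Fin r → Bool, ∑ v : Fin r → Bool,
    if w + ones u + ones v = n then pathWeight k c q (fun s => z + dval u v s) r 0 a else 0

lemma ones_fin_zero (u : Fin 0 → Bool) : ones u = 0 := by
  simp [ones]

lemma freeSum_zero (k : ℕ) (c : ℤ) (x : ℝ) (n : ℕ) (z : ℤ) (w : ℕ) :
    freeSum k c x n 0 z w = if w = n then endWeight k c x z else 0 := by
  simp [freeSum, ones_fin_zero]

lemma confinedSum_zero (k : ℕ) (c : ℤ) (q : ℝ) (n : ℕ) (z : ℤ) (w : ℕ) (a : ℤ) :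
    confinedSum k c q n 0 z w a = if w = n then (if z = c then 1 else 0) else 0 := by
  simp [confinedSum, ones_fin_zero, pathWeight, dval_zero]

lemma sum_pair_succ {r : ℕ} (f : (Fin (r + 1) → Bool) → (Fin (r + 1) → Bool) → ℝ) :
    ∑ u, ∑ v, f u v = ∑ i : Bool, ∑ j : Bool, ∑ u : Fin r → Bool, ∑ v : Fin r → Bool,
      f (Fin.cons i u) (Fin.cons j v) := by
  refine (sum_word_succ fun u => ∑ v, f u v).trans (Finset.sum_congr rfl fun i _ => ?_)
  exact (Finset.sum_congr rfl fun u _ => sum_word_succ (f (Fin.cons i u))).trans Finset.sum_comm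

lemma freeSum_succ (k : ℕ) (c : ℤ) (x : ℝ) (n r : ℕ) (z : ℤ) (w : ℕ) :
    freeSum k c x n (r + 1) z w =
      ∑ i : Bool, ∑ j : Bool,
        freeSum k c x n r (z + (i.toNat - j.toNat)) (w + i.toNat + j.toNat) := by
  unfold freeSum
  rw [sum_pair_succ]
  refine Finset.sum_congr rfl fun i _ => Finset.sum_congr rfl fun j _ =>
    Finset.sum_congr rfl fun u _ => Finset.sum_congr rfl fun v _ => ?_
  rw [ones_cons, ones_cons]
  congr 1
  · rw [eq_iff_iff]
    constructor <;> intro h <;> omega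
  · congr 1
    push_cast
    ring

lemma confinedSum_succ (k : ℕ) (c : ℤ) (q : ℝ) (n r : ℕ) (z : ℤ) (w : ℕ) (a : ℤ) :
    confinedSum k c q n (r + 1) z w a =
      ∑ i : Bool, ∑ j : Bool, stepWeight k q a (z + (i.toNat - j.toNat))
        (confinedSum k c q n r (z + (i.toNat - j.toNat)) (w + i.toNat + j.toNat)) := by
  unfold confinedSum
  rw [sum_pair_succ]
  refine Finset.sum_congr rfl fun i _ => Finset.sum_congr rfl fun j _ => ?_
  rw [← stepWeight_sum]
  refine Finset.sum_congr rfl fun u _ => ?_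
  rw [← stepWeight_sum]
  refine Finset.sum_congr rfl fun v _ => ?_
  rw [← stepWeight_ite, ones_cons, ones_cons, pathWeight]
  simp only [pathWeight_shift, dval_cons_succ, dval_zero, add_zero, add_assoc]
  congr 1
  rw [eq_iff_iff]
  constructor <;> intro h <;> omega

lemma freeSum_add_sub {k : ℕ} (hk : 0 < k) (c : ℤ) (x : ℝ) (n r : ℕ) (z : ℤ) (w : ℕ) :
    freeSum k c x n r (z + 2 * k) w + freeSum k c x n r (z - 2 * k) w
      = 2 * Real.cos x * freeSum k c x n r z w := by
  unfold freeSum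
  simp only [← Finset.sum_add_distrib, Finset.mul_sum]
  refine Finset.sum_congr rfl fun u _ => Finset.sum_congr rfl fun v _ => ?_
  split_ifs
  · rw [← endWeight_add_sub hk]
    congr 2 <;> ring
  · simp

section Transfer

variable {k : ℕ} {c : ℤ} {x : ℝ} {n r : ℕ}

/-- Near last cut value `0`, free and confined sums agree after symmetrization. -/
def SymmAtZero (k : ℕ) (c : ℤ) (x : ℝ) (n r : ℕ) : Prop :=
  ∀ (y : ℤ) (w : ℕ), |y| < k →
    freeSum k c x n r y w + freeSum k c x n r (-y) w
      = confinedSum k c (1 + Real.cos x) n r y w 0 + confinedSum k c (1 + Real.cos x) n r (-y) w 0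

/-- Near last cut values `±k`, free and confined sums agree up to the factor `1 + cos x` after
symmetrization. -/
def SymmAtCut (k : ℕ) (c : ℤ) (x : ℝ) (n r : ℕ) : Prop :=
  ∀ (y : ℤ) (w : ℕ), |y| < k →
    freeSum k c x n r (k + y) w + freeSum k c x n r (k - y) w
        + freeSum k c x n r (-k + y) w + freeSum k c x n r (-k - y) w
      = (1 + Real.cos x) *
        (confinedSum k c (1 + Real.cos x) n r (k + y) w k
          + confinedSum k c (1 + Real.cos x) n r (k - y) w k
          + confinedSum k c (1 + Real.cos x) n r (-k + y) w (-k)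
          + confinedSum k c (1 + Real.cos x) n r (-k - y) w (-k))

lemma symmAtZero_zero (hk : 0 < k) (hc : |c| ≤ k) : SymmAtZero k c x n 0 := by
  intro y w hy
  simp only [freeSum_zero, confinedSum_zero]
  rw [endWeight_near_zero hk hc x hy, endWeight_near_zero hk hc x ((abs_neg y).trans_lt hy)]

lemma symmAtCut_zero (hk : 0 < k) (hc : |c| ≤ k) : SymmAtCut k c x n 0 := by
  intro y w hy
  have h1 := endWeight_near_cut hk hc x hy
  have h2 := endWeight_near_cut hk hc x ((abs_neg y).trans_lt hy)
  simp only [freeSum_zero, confinedSum_zero, sub_eq_add_neg]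
  by_cases hw : w = n
  · simp only [hw, if_true]
    linear_combination h1 + h2
  · simp [hw]

lemma stepWeight_symm_zero (hk : 0 < k) (h0 : SymmAtZero k c x n r) (h1 : SymmAtCut k c x n r)
    (y : ℤ) (w : ℕ) (hy : |y| ≤ k) :
    freeSum k c x n r y w + freeSum k c x n r (-y) w
      = stepWeight k (1 + Real.cos x) 0 y (confinedSum k c (1 + Real.cos x) n r y w)
        + stepWeight k (1 + Real.cos x) 0 (-y)
            (confinedSum k c (1 + Real.cos x) n r (-y) w) := by
  rcases hy.lt_or_eq with hlt | heq
  · have := h0 y w hlt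
    rw [abs_lt] at hlt
    rw [this, stepWeight, if_pos (by omega), if_neg (by omega), stepWeight, if_pos (by omega),
      if_neg (by omega)]
  · have key := h1 0 w (by simpa using hk)
    simp only [add_zero, sub_zero] at key
    have hpos : stepWeight k (1 + Real.cos x) 0 k (confinedSum k c (1 + Real.cos x) n r k w)
        = (1 + Real.cos x) * confinedSum k c (1 + Real.cos x) n r k w k := by
      rw [stepWeight, if_pos (by omega), if_pos (by omega), if_pos (by omega)]
    have hneg : stepWeight k (1 + Real.cos x) 0 (-k)
          (confinedSum k c (1 + Real.cos x) n r (-k) w)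
        = (1 + Real.cos x) * confinedSum k c (1 + Real.cos x) n r (-k) w (-k) := by
      rw [stepWeight, if_pos (by omega), if_pos (by omega), if_pos (by omega)]
    rcases abs_eq (by positivity : (0 : ℤ) ≤ k) |>.1 heq with rfl | rfl
    · rw [hpos, hneg]
      linear_combination key / 2
    · rw [neg_neg, hpos, hneg]
      linear_combination key / 2

lemma stepWeight_symm_cut (hk : 0 < k) (h0 : SymmAtZero k c x n r) (h1 : SymmAtCut k c x n r)
    (y : ℤ) (w : ℕ) (hy : |y| ≤ k) :
    freeSum k c x n r (k + y) w + freeSum k c x n r (k - y) w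
        + freeSum k c x n r (-k + y) w + freeSum k c x n r (-k - y) w
      = (1 + Real.cos x) *
        (stepWeight k (1 + Real.cos x) k (k + y)
            (confinedSum k c (1 + Real.cos x) n r (k + y) w)
          + stepWeight k (1 + Real.cos x) k (k - y)
            (confinedSum k c (1 + Real.cos x) n r (k - y) w)
          + stepWeight k (1 + Real.cos x) (-k) (-k + y)
            (confinedSum k c (1 + Real.cos x) n r (-k + y) w)
          + stepWeight k (1 + Real.cos x) (-k) (-k - y)
            (confinedSum k c (1 + Real.cos x) n r (-k - y) w)) := by
  rcases hy.lt_or_eq with hlt | heq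
  · have := h1 y w hlt
    rw [abs_lt] at hlt
    rw [this]
    congr 1
    iterate 4 rw [stepWeight, if_pos (by omega), if_neg (by omega)]
  · have key := h0 0 w (by simpa using hk)
    have hper := freeSum_add_sub hk c x n r 0 w
    simp only [neg_zero, zero_add, zero_sub] at key hper
    have hzero : ∀ a : ℤ, a = k ∨ a = -k →
        stepWeight k (1 + Real.cos x) a 0 (confinedSum k c (1 + Real.cos x) n r 0 w)
          = confinedSum k c (1 + Real.cos x) n r 0 w 0 := by
      intro a ha
      rw [stepWeight, if_pos (by omega), if_pos (by omega), if_neg (by omega), one_mul]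
    have hout : ∀ (a z : ℤ) (F : ℤ → ℝ), z = 2 * k ∨ z = -(2 * k) →
        stepWeight k (1 + Real.cos x) a z F = 0 := by
      intro a z F hz
      rw [stepWeight, if_neg (by omega)]
    have e1 : (k : ℤ) + k = 2 * k := by ring
    have e2 : -(k : ℤ) - k = -(2 * k) := by ring
    have e3 : (k : ℤ) - k = 0 := by ring
    have e4 : -(k : ℤ) + k = 0 := by ring
    rcases abs_eq (by positivity : (0 : ℤ) ≤ k) |>.1 heq with rfl | rfl
    · rw [e1, e2, e3, e4, hzero _ (.inl rfl), hzero _ (.inr rfl), hout _ _ _ (.inl rfl),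
        hout _ _ _ (.inr rfl)]
      linear_combination hper + (1 + Real.cos x) * key
    · rw [sub_neg_eq_add, sub_neg_eq_add, ← sub_eq_add_neg, ← sub_eq_add_neg, e1, e2, e3, e4,
        hzero _ (.inl rfl), hzero _ (.inr rfl), hout _ _ _ (.inl rfl), hout _ _ _ (.inr rfl)]
      linear_combination hper + (1 + Real.cos x) * key

lemma symm_succ (hk : 0 < k) (h0 : SymmAtZero k c x n r) (h1 : SymmAtCut k c x n r) :
    SymmAtZero k c x n (r + 1) ∧ SymmAtCut k c x n (r + 1) := by
  constructor
  · intro y w hy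
    rw [abs_lt] at hy
    have key := fun (i : ℤ) (w : ℕ) (hi : |i| ≤ 1) =>
      stepWeight_symm_zero hk h0 h1 (y + i) w
        (by rw [abs_le] at *; omega)
    have a1 := key 0 w (by simp)
    have a2 := key 0 (w + 1 + 1) (by simp)
    have a3 := key 1 (w + 1) (by simp)
    have a4 := key (-1) (w + 1) (by simp)
    simp only [neg_add, neg_neg, neg_zero] at a1 a2 a3 a4
    simp only [freeSum_succ, confinedSum_succ, Fintype.sum_bool, Bool.toNat_true,
      Bool.toNat_false, Nat.cast_one, Nat.cast_zero, sub_self, sub_zero, zero_sub,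
      Nat.add_zero]
    linear_combination a1 + a2 + a3 + a4
  · intro y w hy
    rw [abs_lt] at hy
    have key := fun (i : ℤ) (w : ℕ) (hi : |i| ≤ 1) =>
      stepWeight_symm_cut hk h0 h1 (y + i) w
        (by rw [abs_le] at *; omega)
    have a1 := key 0 w (by simp)
    have a2 := key 0 (w + 1 + 1) (by simp)
    have a3 := key 1 (w + 1) (by simp)
    have a4 := key (-1) (w + 1) (by simp)
    simp only [sub_eq_add_neg, neg_add, neg_neg, neg_zero, ← add_assoc] at a1 a2 a3 a4
    simp only [freeSum_succ, confinedSum_succ, Fintype.sum_bool, Bool.toNat_true,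
      Bool.toNat_false, Nat.cast_one, Nat.cast_zero, sub_self, sub_zero, zero_sub,
      Nat.add_zero]
    simp only [sub_eq_add_neg]
    linear_combination a1 + a2 + a3 + a4

end Transfer

lemma freeSum_eq_confinedSum {k : ℕ} {c : ℤ} (hk : 0 < k) (hc : |c| ≤ k) (x : ℝ) (n r : ℕ) :
    freeSum k c x n r 0 0 = confinedSum k c (1 + Real.cos x) n r 0 0 0 := by
  have main : SymmAtZero k c x n r ∧ SymmAtCut k c x n r := by
    induction r with
    | zero => exact ⟨symmAtZero_zero hk hc, symmAtCut_zero hk hc⟩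
    | succ r ih => exact symm_succ hk ih.1 ih.2
  have h := main.1 0 0 (by simpa using hk)
  rw [neg_zero] at h
  linarith

/-- The free sum over all pairs of words of length `M + N`, in closed form. -/
lemma freeSum_closed {k : ℕ} (hk : 0 < k) (M N : ℕ) (x : ℝ) :
    freeSum k ((M : ℤ) - N) x (M + N) (M + N) 0 0 =
      ∑ l ∈ Finset.Icc (-((M : ℤ) + N)) ((M : ℤ) + N),
        (zchoose (M + N) ((M : ℤ) - k * l) : ℝ) ^ 2 * Real.cos (l * x) := by
  have hinner : ∀ u : Fin (M + N) → Bool, (∑ v : Fin (M + N) → Bool,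
      if 0 + ones u + ones v = M + N then
        endWeight k ((M : ℤ) - N) x (0 + ones u - ones v) else 0)
      = ((M + N).choose (ones u) : ℝ) *
        endWeight k ((M : ℤ) - N) x (2 * ones u - (M + N)) := by
    intro u
    have hu : ones u ≤ M + N := (Finset.card_filter_le _ _).trans_eq (by simp)
    rw [sum_word_ones (M + N) fun b => if 0 + ones u + b = M + N then
        endWeight k ((M : ℤ) - N) x (0 + ones u - b) else 0,
      Finset.sum_eq_single (M + N - ones u)]
    · rw [if_pos (by omega), Nat.choose_symm hu]
      congr 2
      push_cast [Nat.cast_sub hu]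
      ring
    · intro b _ hb
      rw [if_neg (by omega), mul_zero]
    · intro hb
      exact absurd (Finset.mem_range.2 (by omega)) hb
  unfold freeSum
  rw [Finset.sum_congr rfl fun u _ => hinner u,
    sum_word_ones (M + N) fun a => ((M + N).choose a : ℝ) *
        endWeight k ((M : ℤ) - N) x (2 * a - (M + N))]
  symm
  refine Finset.sum_bij_ne_zero (fun l _ _ => ((M : ℤ) - k * l).toNat) ?_ ?_ ?_ ?_
  · intro l _ hne
    rw [Finset.mem_range]
    by_contra hlt
    refine hne ?_
    rw [zchoose, if_pos (by omega), Nat.choose_eq_zero_of_lt (by omega)]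
    simp
  · intro l _ hne l' _ hne' heq
    have h1 : 0 ≤ (M : ℤ) - k * l := by
      by_contra h; exact hne (by rw [zchoose, if_neg h]; simp)
    have h2 : 0 ≤ (M : ℤ) - k * l' := by
      by_contra h; exact hne' (by rw [zchoose, if_neg h]; simp)
    have h3 : (k : ℤ) * l = k * l' := by omega
    exact mul_left_cancel₀ (by omega) h3
  · intro a ha hne
    rw [Finset.mem_range] at ha
    have hd : (2 * k : ℤ) ∣ (M : ℤ) - N - (2 * a - (M + N)) := by
      by_contra hd
      exact hne (by rw [endWeight, if_neg hd]; simp)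
    obtain ⟨l, hl⟩ := hd
    have hl' : (M : ℤ) - a = k * l := by linarith
    have ha' : ((M : ℤ) - k * l).toNat = a := by omega
    have habs : |l| ≤ |(M : ℤ) - a| := by
      rw [hl', abs_mul]
      exact le_mul_of_one_le_left (abs_nonneg l) (by rw [Nat.abs_cast]; omega)
    have hb : |(M : ℤ) - a| ≤ M + N := by rw [abs_le]; omega
    refine ⟨l, Finset.mem_Icc.2 (abs_le.1 (habs.trans hb)), ?_, ha'⟩
    rw [endWeight_of_eq hk x l hl] at hne
    rw [zchoose, if_pos (by omega), ha']
    intro h0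
    apply hne
    linear_combination h0
  · intro l _ hne
    have h1 : 0 ≤ (M : ℤ) - k * l := by
      by_contra h; exact hne (by rw [zchoose, if_neg h]; simp)
    have h2 : ((((M : ℤ) - k * l).toNat : ℕ) : ℤ) = (M : ℤ) - k * l := Int.toNat_of_nonneg h1
    rw [zchoose, if_pos h1, endWeight_of_eq hk x l (by rw [h2]; ring)]
    ring

lemma classOf_lt (k n : ℕ) (d : ℕ → ℤ) : classOf k n d < n + 1 := by
  rw [classOf_eq]
  exact Nat.lt_succ_of_le ((List.length_filter_le _ _).trans (length_scanCuts_le k d n 0 0))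

open scoped Classical in
/-- The confined sum over all pairs of words of length `M + N`, grouped by class. -/
lemma confinedSum_closed (k M N : ℕ) (q : ℝ) :
    confinedSum k ((M : ℤ) - N) q (M + N) (M + N) 0 0 0 =
      ∑ p ∈ Finset.range (M + N + 1),
        ((Finset.univ.filter fun uv : (Fin (M + N) → Bool) × (Fin (M + N) → Bool) =>
          ones uv.1 = M ∧ ones uv.2 = N ∧
          classOf k (M + N) (dval uv.1 uv.2) = p ∧
          ∀ s ∈ Finset.Icc 1 (M + N),
            -(2 * k : ℤ) < dval uv.1 uv.2 s ∧ dval uv.1 uv.2 s < 2 * k).card : ℝ) * q ^ p := by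
  simp only [Finset.card_filter, Nat.cast_sum, Finset.sum_mul]
  rw [Finset.sum_comm, Fintype.sum_prod_type]
  unfold confinedSum
  refine Finset.sum_congr rfl fun u _ => Finset.sum_congr rfl fun v _ => ?_
  rw [Finset.sum_eq_single (classOf k (M + N) (dval u v))]
  · have h := pathWeight_eq k ((M : ℤ) - N) q (dval u v) (M + N) 0 0
    rw [dval_zero, Nat.zero_add, dval_length, ← classOf_eq] at h
    simp only [zero_add]
    rw [h]
    have hIcc : Finset.Icc 1 (M + N) = Finset.Ioc 0 (M + N) := rfl
    rw [hIcc]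
    by_cases hr : ∀ s ∈ Finset.Ioc 0 (M + N), -(2 * k : ℤ) < dval u v s ∧ dval u v s < 2 * k
    · by_cases h1 : ones u = M ∧ ones v = N
      · rw [if_pos (by omega), if_pos ⟨hr, by omega⟩, if_pos ⟨h1.1, h1.2, trivial, hr⟩]
        simp
      · rw [if_neg (c := _ ∧ _) fun h => h1 ⟨h.1, h.2.1⟩, Nat.cast_zero, zero_mul]
        split_ifs with h2 h3
        · omega
        · rfl
        · rfl
    · rw [if_neg (c := _ ∧ _) fun h => hr h.1, if_neg (c := _ ∧ _) fun h => hr h.2.2.2]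
      simp
  · intro p _ hp
    rw [if_neg fun h => hp h.2.2.1.symm, Nat.cast_zero, zero_mul]
  · intro h
    exact absurd (Finset.mem_range.2 (classOf_lt k (M + N) (dval u v))) h

open scoped Classical in
theorem stmt6 (k M N : ℕ) (hk : 0 < k) (h : |(M : ℤ) - N| ≤ k)
    (b : ℕ → ℕ)
    (hb : ∀ p : ℕ, b p =
      (Finset.univ.filter fun uv : (Fin (M + N) → Bool) × (Fin (M + N) → Bool) =>
        ones uv.1 = M ∧ ones uv.2 = N ∧
        classOf k (M + N) (dval uv.1 uv.2) = p ∧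
        ∀ s ∈ Finset.Icc 1 (M + N),
          -(2 * k : ℤ) < dval uv.1 uv.2 s ∧ dval uv.1 uv.2 s < 2 * k).card) :
    ∀ x : ℝ,
      ∑ l ∈ Finset.Icc (-((M : ℤ) + N)) ((M : ℤ) + N),
        (zchoose (M + N) ((M : ℤ) - k * l) : ℝ) ^ 2 * Real.cos (l * x)
      = ∑ p ∈ Finset.range (M + N + 1), (b p : ℝ) * (1 + Real.cos x) ^ p := by
  intro x
  rw [← freeSum_closed hk, freeSum_eq_confinedSum hk h, confinedSum_closed]
  simp only [hb]
end

section
/- Let M be a nonnegative integer. Then for every real number x, ∑_{l=−M}^{M} C(2M, M−l)^2 · cos(l·x) = ∑_{p=0}^{M} ((2M)! · 2^p) / ((M−p)!^2 · (2p)!) · (1 + cos x)^p. -/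
theorem add_choose_left_mul_factorial_mul_factorial (i j : ℕ) :
    (i + j).choose i * i.factorial * j.factorial = (i + j).factorial := by
  rw [Nat.choose_symm_add, Nat.add_choose_mul_factorial_mul_factorial]

open Finset in
/-- A symmetric form of Vandermonde's identity. -/
theorem sum_choose_mul_choose_sub {n k : ℕ} (hk : k ≤ n) :
    ∑ j ∈ range (n + 1), k.choose j * (n - k).choose j = n.choose k := by
  have hsub : range (k + 1) ⊆ range (n + 1) := range_subset_range.2 (by omega)
  rw [← sum_subset hsub fun j _ hj => by
    rw [Nat.choose_eq_zero_of_lt (by simpa using hj), zero_mul]]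
  conv_rhs => rw [← Nat.add_sub_of_le hk, Nat.add_choose_eq, ← Nat.sum_antidiagonal_swap,
    Nat.sum_antidiagonal_eq_sum_range_succ_mk]
  refine sum_congr rfl fun j hj => ?_
  simp [Nat.choose_symm (Nat.lt_succ_iff.1 (mem_range.1 hj))]

/-- Two ways of writing a multinomial coefficient as a product of binomial coefficients. -/
theorem choose_two_mul_mul_choose_mul_choose (n k j : ℕ) :
    n.choose (2 * j) * (2 * j).choose j * (if j ≤ k then (n - 2 * j).choose (k - j) else 0) =
      n.choose k * (k.choose j * (n - k).choose j) := by
  split_ifs with hjk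
  · by_cases hjn : k + j ≤ n
    · obtain ⟨a, rfl⟩ := Nat.exists_eq_add_of_le hjk
      obtain ⟨b, rfl⟩ := Nat.exists_eq_add_of_le hjn
      have hb : j + a + j + b - (j + a) = j + b := by omega
      have ha : j + a + j + b - 2 * j = a + b := by omega
      have hn : j + a + j + b = 2 * j + (a + b) := by omega
      have hn' : j + a + j + b = (j + a) + (j + b) := by omega
      rw [hb, ha, Nat.add_sub_cancel_left]
      have h1 := add_choose_left_mul_factorial_mul_factorial (2 * j) (a + b)
      have h2 := add_choose_left_mul_factorial_mul_factorial j j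
      have h3 := add_choose_left_mul_factorial_mul_factorial a b
      have h4 := add_choose_left_mul_factorial_mul_factorial (j + a) (j + b)
      have h5 := add_choose_left_mul_factorial_mul_factorial j a
      have h6 := add_choose_left_mul_factorial_mul_factorial j b
      rw [← hn] at h1
      rw [← hn'] at h4
      rw [← two_mul] at h2
      have hpos : 0 < j.factorial * j.factorial * a.factorial * b.factorial := by positivity
      apply Nat.eq_of_mul_eq_mul_right hpos
      rw [← h2, ← h3] at h1
      rw [← h5, ← h6] at h4
      linarith only [h1, h4]
    · have hzero : n.choose (2 * j) * (n - 2 * j).choose (k - j) = 0 := by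
        by_cases h : 2 * j ≤ n
        · rw [Nat.choose_eq_zero_of_lt (show n - 2 * j < k - j by omega), mul_zero]
        · rw [Nat.choose_eq_zero_of_lt (not_le.1 h), zero_mul]
      have hzero' : n.choose k * (n - k).choose j = 0 := by
        by_cases h : k ≤ n
        · rw [Nat.choose_eq_zero_of_lt (show n - k < j by omega), mul_zero]
        · rw [Nat.choose_eq_zero_of_lt (not_le.1 h), zero_mul]
      rw [mul_right_comm, hzero, mul_left_comm, hzero', zero_mul, mul_zero]
  · rw [Nat.choose_eq_zero_of_lt (not_le.1 hjk), mul_zero, zero_mul, mul_zero]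

open Finset Polynomial in
theorem sum_choose_sq_mul_X_pow (n : ℕ) :
    ∑ k ∈ range (n + 1), ((n.choose k ^ 2 : ℕ) : ℕ[X]) * X ^ k =
      ∑ j ∈ range (n + 1),
        ((n.choose (2 * j) * (2 * j).choose j : ℕ) : ℕ[X]) *
          (X ^ j * (1 + X) ^ (n - 2 * j)) := by
  ext k
  simp only [finsetSum_coeff, coeff_natCast_mul, coeff_X_pow_mul', coeff_one_add_X_pow, Nat.cast_id,
    choose_two_mul_mul_choose_mul_choose]
  simp only [coeff_X_pow, ← mul_sum, mul_ite, mul_one, mul_zero, sum_ite_eq, mem_range]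
  split_ifs with hk
  · rw [sum_choose_mul_choose_sub (Nat.lt_succ_iff.1 hk), sq]
  · rw [Nat.choose_eq_zero_of_lt (by omega), zero_mul]

open Finset Polynomial in
/-- The generating polynomial of the squares of the binomial coefficients, expanded in
`z ^ j * (1 + z) ^ (n - 2 * j)`. -/
theorem sum_choose_sq_mul_pow {R : Type*} [CommSemiring R] (n : ℕ) (z : R) :
    ∑ k ∈ range (n + 1), (n.choose k : R) ^ 2 * z ^ k =
      ∑ j ∈ range (n + 1),
        ((n.choose (2 * j) * (2 * j).choose j : ℕ) : R) * (z ^ j * (1 + z) ^ (n - 2 * j)) := by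
  simpa [eval₂_finsetSum] using congrArg (aeval z) (sum_choose_sq_mul_X_pow n)

open Finset in
theorem sum_choose_sq_mul_cos (M : ℕ) (x : ℝ) :
    ∑ k ∈ range (2 * M + 1), ((2 * M).choose k : ℝ) ^ 2 * Real.cos ((M - k) * x) =
      ∑ j ∈ range (M + 1), (((2 * M).choose (2 * j) * (2 * j).choose j : ℕ) : ℝ) *
        (2 * (1 + Real.cos x)) ^ (M - j) := by
  set z : ℂ := Complex.exp (x * Complex.I) with hz
  set w : ℂ := Complex.exp (-(x * Complex.I)) with hw
  have hwz : w * z = 1 := by rw [hw, hz, ← Complex.exp_add, neg_add_cancel, Complex.exp_zero]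
  have hcos : w * (1 + z) ^ 2 = ((2 * (1 + Real.cos x) : ℝ) : ℂ) := by
    have h : 2 * Complex.cos x = z + w := by
      rw [Complex.two_cos, hz, hw, neg_mul]
    push_cast
    linear_combination (2 + z) * hwz - h
  have hterm (k : ℕ) : (w ^ M * z ^ k).re = Real.cos ((M - k) * x) := by
    rw [hw, hz, ← Complex.exp_nat_mul, ← Complex.exp_nat_mul, ← Complex.exp_add,
      ← Real.cos_neg, ← Complex.exp_ofReal_mul_I_re]
    congr 2
    push_cast
    ring
  have key := congrArg (fun s => (w ^ M * s).re) (sum_choose_sq_mul_pow (2 * M) z)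
  have hsub : range (M + 1) ⊆ range (2 * M + 1) := range_subset_range.2 (by omega)
  simp only [mul_sum, Complex.re_sum] at key
  rw [eq_comm, ← sum_subset hsub fun j _ hj => by
    rw [Nat.choose_eq_zero_of_lt (show 2 * M < 2 * j by rw [mem_range] at hj; omega)]
    simp, eq_comm] at key
  refine (sum_congr rfl fun k _ => ?_).trans (key.trans (sum_congr rfl fun j hj => ?_))
  · rw [← hterm, mul_left_comm, ← Complex.ofReal_natCast, ← Complex.ofReal_pow, Complex.re_ofReal_mul]
  · obtain ⟨p, rfl⟩ := Nat.exists_eq_add_of_le (Nat.lt_succ_iff.1 (mem_range.1 hj))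
    have hp : w ^ (j + p) * (z ^ j * (1 + z) ^ (2 * (j + p) - 2 * j)) =
        (((2 * (1 + Real.cos x)) ^ p : ℝ) : ℂ) := by
      rw [Complex.ofReal_pow, ← hcos, show 2 * (j + p) - 2 * j = 2 * p by omega, pow_add,
        mul_pow w, pow_mul (1 + z)]
      have h : w ^ j * z ^ j = 1 := by rw [← mul_pow, hwz, one_pow]
      linear_combination (w ^ p * ((1 + z) ^ 2) ^ p) * h
    rw [mul_left_comm, hp, ← Complex.ofReal_natCast, Complex.re_ofReal_mul, Complex.ofReal_re,
      Nat.add_sub_cancel_left]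

theorem stmt8 (M : ℕ) (x : ℝ) :
    ∑ l ∈ Finset.Icc (-(M : ℤ)) (M : ℤ),
      (zchoose (2 * M) ((M : ℤ) - l) : ℝ) ^ 2 * Real.cos (l * x)
    = ∑ p ∈ Finset.range (M + 1),
        ((2 * M).factorial * 2 ^ p : ℝ) /
          (((M - p).factorial : ℝ) ^ 2 * ((2 * p).factorial : ℝ)) * (1 + Real.cos x) ^ p := by
  have hleft : ∑ l ∈ Finset.Icc (-(M : ℤ)) (M : ℤ),
      (zchoose (2 * M) ((M : ℤ) - l) : ℝ) ^ 2 * Real.cos (l * x) =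
      ∑ k ∈ Finset.range (2 * M + 1),
        ((2 * M).choose k : ℝ) ^ 2 * Real.cos ((M - k) * x) := by
    symm
    refine Finset.sum_bij' (fun k _ => (M : ℤ) - k) (fun l _ => ((M : ℤ) - l).toNat)
      ?_ ?_ ?_ ?_ ?_
    · intro k hk
      simp only [Finset.mem_range, Finset.mem_Icc] at hk ⊢
      omega
    · intro l hl
      simp only [Finset.mem_range, Finset.mem_Icc] at hl ⊢
      omega
    · intro k _
      simp
    · intro l hl
      simp only [Finset.mem_Icc] at hl
      omega
    · intro k _
      simp [zchoose]
  rw [hleft, sum_choose_sq_mul_cos, ← Finset.sum_range_reflect]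
  refine Finset.sum_congr rfl fun p hp => ?_
  obtain ⟨j, rfl⟩ := Nat.exists_eq_add_of_le (Nat.lt_succ_iff.1 (Finset.mem_range.1 hp))
  rw [show p + j + 1 - 1 - p = j by omega, show p + j - j = p by omega,
    show p + j - p = j by omega, mul_pow, ← mul_assoc]
  congr 1
  have h1 := add_choose_left_mul_factorial_mul_factorial (2 * j) (2 * p)
  have h2 := add_choose_left_mul_factorial_mul_factorial j j
  rw [← two_mul] at h2
  rw [← h2, show 2 * j + 2 * p = 2 * (p + j) by ring] at h1
  rw [eq_div_iff (by positivity), ← h1]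
  push_cast
  ring
end

section
/- Let M be a nonnegative integer. Then for every real number x, ∑_{l=−M−1}^{M} C(2M+1, M−l)^2 · cos(l·x) = ∑_{p=1}^{M+1} ((2M+1)! · 2^{p−1}) / ((M−p+1)!^2 · (2p−1)!) · (1 + cos x)^p. -/
theorem Finset.sum_range_two_mul {A : Type*} [AddCommMonoid A] (f : ℕ → A) (N : ℕ) :
    ∑ m ∈ Finset.range (2 * N), f m = ∑ k ∈ Finset.range N, (f (2 * k) + f (2 * k + 1)) := by
  induction N with
  | zero => simp
  | succ N ih =>
    rw [Finset.sum_range_succ, ← ih, show 2 * (N + 1) = 2 * N + 1 + 1 by ring,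
      Finset.sum_range_succ, Finset.sum_range_succ, add_assoc]

open Polynomial in
/-- The coefficient of `X ^ n` in `((1 + X) * (X + t)) ^ n`, computed in two ways. -/
theorem sum_choose_sq_mul_pow_s9 {R : Type*} [CommRing R] (n : ℕ) (t : R) :
    ∑ j ∈ Finset.range (n + 1), (n.choose j : R) ^ 2 * t ^ j =
      ∑ m ∈ Finset.range (n + 1),
        if 2 ∣ m then (n.choose m * m.choose (m / 2) : R) * t ^ (m / 2) * (1 + t) ^ (n - m)
        else 0 := by
  have key : ((1 + X) ^ n * (X + C t) ^ n : R[X]) =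
      (expand R 2 (X + C t) + C (1 + t) * X) ^ n := by
    rw [← mul_pow]
    congr 1
    simp only [map_add, expand_X, expand_C, C_1]
    ring
  have h := congrArg (fun q : R[X] => q.coeff n) key
  simp only [coeff_mul] at h
  rw [Finset.Nat.sum_antidiagonal_eq_sum_range_succ_mk,
    add_pow (expand R 2 (X + C t)), finsetSum_coeff] at h
  refine Eq.trans (Finset.sum_congr rfl fun j hj => ?_)
    (h.trans (Finset.sum_congr rfl fun m hm => ?_))
  · have hj' : j ≤ n := by simpa [Nat.lt_succ_iff] using hj
    simp only [coeff_one_add_X_pow, coeff_X_add_C_pow, Nat.choose_symm hj', Nat.sub_sub_self hj']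
    ring
  · have hm' : m ≤ n := by simpa [Nat.lt_succ_iff] using hm
    rw [← map_pow, mul_pow, ← C_pow, ← C_eq_natCast, coeff_mul_C, ← mul_assoc, coeff_mul_X_pow',
      if_pos (Nat.sub_le n m), Nat.sub_sub_self hm', coeff_mul_C, coeff_expand two_pos]
    split_ifs with hd
    · obtain ⟨k, rfl⟩ := hd
      rw [coeff_X_add_C_pow, Nat.mul_div_cancel_left k two_pos, show 2 * k - k = k by omega]
      ring
    · simp

theorem choose_mul_centralBinom_eq_div {K : Type*} [Field K] [CharZero K] {n k : ℕ}
    (h : 2 * k ≤ n) :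
    (n.choose (2 * k) * (2 * k).choose k : K) =
      n.factorial / ((k.factorial : K) ^ 2 * (n - 2 * k).factorial) := by
  rw [Nat.cast_choose K h, Nat.cast_choose K (show k ≤ 2 * k by omega),
    show 2 * k - k = k by omega]
  have := Nat.cast_ne_zero (R := K).2 (Nat.factorial_ne_zero (2 * k))
  have := Nat.cast_ne_zero (R := K).2 (Nat.factorial_ne_zero k)
  have := Nat.cast_ne_zero (R := K).2 (Nat.factorial_ne_zero (n - 2 * k))
  field_simp

theorem sum_choose_sq_mul_pow_odd {K : Type*} [Field K] [CharZero K] (M : ℕ) (t : K) :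
    ∑ j ∈ Finset.range (2 * M + 2), ((2 * M + 1).choose j : K) ^ 2 * t ^ j =
      ∑ k ∈ Finset.range (M + 1),
        ((2 * M + 1).factorial / ((k.factorial : K) ^ 2 * (2 * M + 1 - 2 * k).factorial)) *
          t ^ k * (1 + t) ^ (2 * M + 1 - 2 * k) := by
  rw [sum_choose_sq_mul_pow_s9, show 2 * M + 1 + 1 = 2 * (M + 1) by ring, Finset.sum_range_two_mul]
  refine Finset.sum_congr rfl fun k hk => ?_
  have hk' : k < M + 1 := by simpa using hk
  rw [if_pos (dvd_mul_right 2 k), if_neg (by omega), add_zero,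
    Nat.mul_div_cancel_left k two_pos, choose_mul_centralBinom_eq_div (by omega)]

theorem exp_pow_mul_one_add_exp_neg_pow_re (q : ℕ) (x : ℝ) :
    (Complex.exp (x * Complex.I) ^ q * (1 + Complex.exp (-(x * Complex.I))) ^ (2 * q + 1)).re =
      2 ^ q * (1 + Real.cos x) ^ (q + 1) := by
  have h1 : Complex.exp (x * Complex.I) * (1 + Complex.exp (-(x * Complex.I))) ^ 2 =
      ((2 * (1 + Real.cos x) : ℝ) : ℂ) := by
    have h2 := Complex.two_cos (x : ℂ)
    have h3 : Complex.exp (x * Complex.I) * Complex.exp (-(x * Complex.I)) = 1 := by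
      rw [← Complex.exp_add, add_neg_cancel, Complex.exp_zero]
    rw [neg_mul] at h2
    push_cast
    linear_combination (2 + Complex.exp (-(x * Complex.I))) * h3 - h2
  rw [pow_succ, pow_mul, ← mul_assoc, ← mul_pow, h1, ← Complex.ofReal_pow,
    Complex.re_ofReal_mul, Complex.add_re, Complex.one_re, ← neg_mul, ← Complex.ofReal_neg,
    Complex.exp_ofReal_mul_I_re, Real.cos_neg, mul_pow]
  ring

theorem sum_zchoose_sq_mul_cos (M : ℕ) (x : ℝ) :
    ∑ l ∈ Finset.Icc (-(M : ℤ) - 1) (M : ℤ),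
      (zchoose (2 * M + 1) ((M : ℤ) - l) : ℝ) ^ 2 * Real.cos (l * x) =
    (Complex.exp (x * Complex.I) ^ M * ∑ j ∈ Finset.range (2 * M + 2),
      ((2 * M + 1).choose j : ℂ) ^ 2 * Complex.exp (-(x * Complex.I)) ^ j).re := by
  rw [Finset.mul_sum, Complex.re_sum]
  refine Finset.sum_bij' (fun l _ => ((M : ℤ) - l).toNat) (fun j _ => (M : ℤ) - j)
    ?_ ?_ ?_ ?_ ?_
  · intro l hl; simp only [Finset.mem_Icc, Finset.mem_range] at *; omega
  · intro l hl; simp only [Finset.mem_Icc, Finset.mem_range] at *; omega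
  · intro l hl; simp only [Finset.mem_Icc] at *; omega
  · intro l hl; simp
  · intro l hl
    obtain ⟨j, hj⟩ := Int.eq_ofNat_of_zero_le (show 0 ≤ (M : ℤ) - l by
      simp only [Finset.mem_Icc] at hl; omega)
    obtain rfl : l = (M : ℤ) - j := by omega
    have hexp : Complex.exp (x * Complex.I) ^ M * Complex.exp (-(x * Complex.I)) ^ j =
        Complex.exp (((((M : ℤ) - j : ℤ) : ℝ) * x : ℝ) * Complex.I) := by
      rw [← Complex.exp_nat_mul, ← Complex.exp_nat_mul, ← Complex.exp_add]
      congr 1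
      push_cast
      ring
    rw [hj, Int.toNat_natCast, mul_left_comm, hexp, ← Complex.ofReal_natCast,
      ← Complex.ofReal_pow, Complex.re_ofReal_mul, Complex.exp_ofReal_mul_I_re]
    simp [zchoose]

theorem stmt9 (M : ℕ) (x : ℝ) :
    ∑ l ∈ Finset.Icc (-(M : ℤ) - 1) (M : ℤ),
      (zchoose (2 * M + 1) ((M : ℤ) - l) : ℝ) ^ 2 * Real.cos (l * x)
    = ∑ p ∈ Finset.Icc 1 (M + 1),
        ((2 * M + 1).factorial * 2 ^ (p - 1) : ℝ) /
          (((M + 1 - p).factorial : ℝ) ^ 2 * ((2 * p - 1).factorial : ℝ)) *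
          (1 + Real.cos x) ^ p := by
  rw [sum_zchoose_sq_mul_cos, sum_choose_sq_mul_pow_odd, Finset.mul_sum, Complex.re_sum]
  refine Finset.sum_bij' (fun k _ => M + 1 - k) (fun p _ => M + 1 - p) ?_ ?_ ?_ ?_ ?_
  · intro k hk; simp only [Finset.mem_Icc, Finset.mem_range] at *; omega
  · intro p hp; simp only [Finset.mem_Icc, Finset.mem_range] at *; omega
  · intro k hk; simp only [Finset.mem_range] at *; omega
  · intro p hp; simp only [Finset.mem_Icc] at *; omega
  · intro k hk
    obtain ⟨q, rfl⟩ : ∃ q, M = q + k :=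
      ⟨M - k, by simp only [Finset.mem_range] at hk; omega⟩
    have hz : Complex.exp (x * Complex.I) ^ k * Complex.exp (-(x * Complex.I)) ^ k = 1 := by
      rw [← mul_pow, ← Complex.exp_add, add_neg_cancel, Complex.exp_zero, one_pow]
    rw [show q + k + 1 - (q + k + 1 - k) = k by omega, show q + k + 1 - k = q + 1 by omega,
      show 2 * (q + k) + 1 - 2 * k = 2 * q + 1 by omega, show 2 * (q + 1) - 1 = 2 * q + 1 by omega,
      Nat.add_sub_cancel, mul_div_right_comm, mul_assoc _ ((2 : ℝ) ^ q),
      ← exp_pow_mul_one_add_exp_neg_pow_re, ← Complex.re_ofReal_mul]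
    congr 1
    push_cast
    rw [pow_add]
    linear_combination (((2 * (q + k) + 1).factorial : ℂ) /
      ((k.factorial : ℂ) ^ 2 * (2 * q + 1).factorial) * Complex.exp (x * Complex.I) ^ q *
      (1 + Complex.exp (-(x * Complex.I))) ^ (2 * q + 1)) * hz
end

section
/- Let M be a nonnegative integer. Then for every real number x, ∑_{l=−M}^{M} C(2M+1, M−l) · C(2M+1, M+l) · cos(l·x) = ∑_{p=0}^{M} ((2M+1)! · 2^p) / ((M−p)! · (M−p+1)! · (2p)!) · (1 + cos x)^p. -/
/-- Expansion of `(2 + 2 cos x) ^ p = (2 cos (x / 2)) ^ (2 * p)` in cosines of multiples of `x`. -/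
theorem two_add_two_cos_pow (p : ℕ) (x : ℝ) :
    (2 + 2 * Real.cos x) ^ p =
      ∑ i ∈ Finset.range (2 * p + 1), ((2 * p).choose i : ℝ) * Real.cos (((p : ℝ) - i) * x) := by
  have hC : (((2 + 2 * Real.cos x) ^ p : ℝ) : ℂ) =
      ∑ i ∈ Finset.range (2 * p + 1),
        (((2 * p).choose i : ℝ) : ℂ) * Complex.exp (((((p : ℝ) - i) * x : ℝ) : ℂ) * Complex.I) := by
    have hbase : (2 + 2 * Complex.cos x : ℂ) =
        Complex.exp (x * Complex.I) * (Complex.exp (-x * Complex.I) + 1) ^ 2 := by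
      have h : Complex.exp (x * Complex.I) * Complex.exp (-x * Complex.I) = 1 := by
        rw [← Complex.exp_add]; simp
      rw [Complex.two_cos]
      linear_combination (-2 - Complex.exp (-x * Complex.I)) * h
    push_cast
    rw [hbase, mul_pow, ← pow_mul, add_pow, Finset.mul_sum]
    refine Finset.sum_congr rfl fun i _ => ?_
    rw [← Complex.exp_nat_mul, ← Complex.exp_nat_mul, one_pow, mul_one, ← mul_assoc,
      ← Complex.exp_add, mul_comm]
    congr 2
    ring
  have hre := congrArg Complex.re hC
  rw [Complex.ofReal_re, Complex.re_sum] at hre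
  rw [hre]
  refine Finset.sum_congr rfl fun i _ => ?_
  rw [Complex.re_ofReal_mul, Complex.exp_ofReal_mul_I_re]

/-- A sum over `range (2 * M + 1)` whose terms vanish at distance more than `p` from `M = a + p`. -/
theorem sum_range_eq_sum_centered (a p : ℕ) (f : ℕ → ℝ) (hlo : ∀ k < a, f k = 0)
    (hhi : ∀ k, a + 2 * p < k → k < 2 * (a + p) + 1 → f k = 0) :
    ∑ k ∈ Finset.range (2 * (a + p) + 1), f k = ∑ i ∈ Finset.range (2 * p + 1), f (a + i) := by
  rw [show 2 * (a + p) + 1 = a + ((2 * p + 1) + a) by ring, Finset.sum_range_add,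
    Finset.sum_range_add, Finset.sum_eq_zero fun k hk => hlo k (Finset.mem_range.1 hk),
    Finset.sum_eq_zero (s := Finset.range a) fun k hk => hhi _ (by omega)
      (by rw [Finset.mem_range] at hk; omega)]
  ring

/-- A form of Vandermonde's identity. -/
theorem sum_choose_mul_choose_succ (M k : ℕ) (hk : k ≤ 2 * M) :
    ∑ a ∈ Finset.range (M + 1), (2 * M - k).choose a * (k + 1).choose (a + 1) =
      (2 * M + 1).choose k := by
  have hvan := Nat.add_choose_eq (2 * M - k) (k + 1) k
  rw [show 2 * M - k + (k + 1) = 2 * M + 1 by omega,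
    Finset.Nat.sum_antidiagonal_eq_sum_range_succ
      (fun i j => (2 * M - k).choose i * (k + 1).choose j)] at hvan
  rw [hvan]
  have hsymm : ∀ a ∈ Finset.range (k + 1),
      (2 * M - k).choose a * (k + 1).choose (k - a) =
        (2 * M - k).choose a * (k + 1).choose (a + 1) := by
    intro a ha
    rw [Finset.mem_range] at ha
    rw [← Nat.choose_symm (show a + 1 ≤ k + 1 by omega), Nat.add_sub_add_right]
  rw [Finset.sum_congr rfl hsymm]
  have hzero : ∀ a, min (M + 1) (k + 1) ≤ a →
      (2 * M - k).choose a * (k + 1).choose (a + 1) = 0 := by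
    intro a ha
    rcases lt_or_ge k a with h | h
    · rw [Nat.choose_eq_zero_of_lt (show k + 1 < a + 1 by omega), mul_zero]
    · rw [Nat.choose_eq_zero_of_lt (show 2 * M - k < a by omega), zero_mul]
  have hsub : ∀ n, min (M + 1) (k + 1) ≤ n →
      ∑ a ∈ Finset.range n, (2 * M - k).choose a * (k + 1).choose (a + 1) =
        ∑ a ∈ Finset.range (min (M + 1) (k + 1)),
          (2 * M - k).choose a * (k + 1).choose (a + 1) := fun n hn =>
    (Finset.sum_subset (Finset.range_mono hn) fun a _ ha =>
      hzero a (by simpa only [Finset.mem_range, not_lt] using ha)).symm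
  rw [hsub _ (min_le_left _ _), hsub _ (min_le_right _ _)]

theorem factorial_div_mul_choose (a p i : ℕ) (hi : i ≤ 2 * p) :
    ((2 * (a + p) + 1).factorial : ℝ) /
        ((a.factorial : ℝ) * ((a + 1).factorial : ℝ) * ((2 * p).factorial : ℝ)) *
        ((2 * p).choose i : ℝ) =
      ((2 * (a + p) + 1).choose (2 * (a + p) - (a + i)) : ℝ) *
        (((2 * (a + p) - (a + i)).choose a : ℝ) * ((a + i + 1).choose (a + 1) : ℝ)) := by
  obtain ⟨j, hj⟩ := Nat.exists_eq_add_of_le hi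
  rw [show 2 * (a + p) - (a + i) = a + j by omega,
    show 2 * (a + p) + 1 = (a + j) + (a + i + 1) by omega, hj,
    show a + i + 1 = (a + 1) + i by ring, Nat.cast_add_choose, Nat.cast_add_choose,
    Nat.cast_add_choose, Nat.cast_add_choose]
  have := fun n : ℕ => (Nat.cast_ne_zero (R := ℝ)).2 n.factorial_ne_zero
  have h1 := this a
  have h2 := this (a + 1)
  have h3 := this (i + j)
  have h4 := this i
  have h5 := this j
  have h6 := this (a + j)
  have h7 := this (a + 1 + i)
  field_simp

theorem factorial_div_mul_cos_pow (M a : ℕ) (ha : a ≤ M) (x : ℝ) :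
    ((2 * M + 1).factorial * 2 ^ (M - a) : ℝ) /
        ((a.factorial : ℝ) * ((a + 1).factorial : ℝ) * ((2 * (M - a)).factorial : ℝ)) *
        (1 + Real.cos x) ^ (M - a) =
      ∑ k ∈ Finset.range (2 * M + 1),
        ((2 * M + 1).choose (2 * M - k) : ℝ) *
          (((2 * M - k).choose a : ℝ) * ((k + 1).choose (a + 1) : ℝ)) *
          Real.cos (((M : ℝ) - k) * x) := by
  obtain ⟨p, rfl⟩ := Nat.exists_eq_add_of_le ha
  rw [Nat.add_sub_cancel_left, sum_range_eq_sum_centered a p]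
  · have hpow : (2 : ℝ) ^ p * (1 + Real.cos x) ^ p = (2 + 2 * Real.cos x) ^ p := by
      rw [← mul_pow]; ring
    rw [mul_div_right_comm, mul_assoc, hpow, two_add_two_cos_pow, Finset.mul_sum]
    refine Finset.sum_congr rfl fun i hi => ?_
    rw [← mul_assoc,
      factorial_div_mul_choose a p i (Nat.lt_succ_iff.1 (Finset.mem_range.1 hi))]
    congr 2
    push_cast
    ring
  · intro k hk
    rw [Nat.choose_eq_zero_of_lt (show k + 1 < a + 1 by omega)]
    simp
  · intro k hk hk'
    rw [Nat.choose_eq_zero_of_lt (show 2 * (a + p) - k < a by omega)]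
    simp

theorem stmt10 (M : ℕ) (x : ℝ) :
    ∑ l ∈ Finset.Icc (-(M : ℤ)) (M : ℤ),
      (zchoose (2 * M + 1) ((M : ℤ) - l) : ℝ) *
        (zchoose (2 * M + 1) ((M : ℤ) + l) : ℝ) * Real.cos (l * x)
    = ∑ p ∈ Finset.range (M + 1),
        ((2 * M + 1).factorial * 2 ^ p : ℝ) /
          (((M - p).factorial : ℝ) * ((M + 1 - p).factorial : ℝ) * ((2 * p).factorial : ℝ)) *
          (1 + Real.cos x) ^ p := by
  have hlhs : ∑ l ∈ Finset.Icc (-(M : ℤ)) (M : ℤ),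
      (zchoose (2 * M + 1) ((M : ℤ) - l) : ℝ) *
        (zchoose (2 * M + 1) ((M : ℤ) + l) : ℝ) * Real.cos (l * x) =
      ∑ k ∈ Finset.range (2 * M + 1),
        ((2 * M + 1).choose k : ℝ) * ((2 * M + 1).choose (2 * M - k) : ℝ) *
          Real.cos (((M : ℝ) - k) * x) := by
    symm
    refine Finset.sum_bij' (fun k _ => (M : ℤ) - k) (fun l _ => ((M : ℤ) - l).toNat)
      ?_ ?_ ?_ ?_ ?_
    · intro k hk
      simp only [Finset.mem_range, Finset.mem_Icc] at hk ⊢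
      omega
    · intro l hl
      simp only [Finset.mem_range, Finset.mem_Icc] at hl ⊢
      omega
    · intro k _
      simp
    · intro l hl
      simp only [Finset.mem_Icc] at hl
      omega
    · intro k hk
      rw [Finset.mem_range] at hk
      rw [zchoose, zchoose, if_pos (by omega), if_pos (by omega),
        show ((M : ℤ) - (M - k)).toNat = k by omega,
        show ((M : ℤ) + (M - k)).toNat = 2 * M - k by omega]
      push_cast
      rfl
  rw [hlhs, ← Finset.sum_range_reflect _ (M + 1)]
  symm
  calc
    _ = ∑ a ∈ Finset.range (M + 1), ∑ k ∈ Finset.range (2 * M + 1),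
        ((2 * M + 1).choose (2 * M - k) : ℝ) *
          (((2 * M - k).choose a : ℝ) * ((k + 1).choose (a + 1) : ℝ)) *
          Real.cos (((M : ℝ) - k) * x) := by
      refine Finset.sum_congr rfl fun a ha => ?_
      have ha' : a ≤ M := Nat.lt_succ_iff.1 (Finset.mem_range.1 ha)
      rw [← factorial_div_mul_cos_pow M a ha', Nat.add_sub_cancel,
        show M - (M - a) = a by omega, show M + 1 - (M - a) = a + 1 by omega]
    _ = _ := by
      rw [Finset.sum_comm]
      refine Finset.sum_congr rfl fun k hk => ?_
      rw [← Finset.sum_mul, ← Finset.mul_sum,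
        ← sum_choose_mul_choose_succ M k (Nat.lt_succ_iff.1 (Finset.mem_range.1 hk))]
      push_cast
      ring
end
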